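/- arXiv:2105.06573 — 6 statements merged into one kernel-verified Lean document; each statement's English description precedes it below -/
import Mathlib

section
/- Let μ be the uniform probability measure on the standard simplex Δ^{n-1} ⊂ ℝ^n, R ∈ ℝ^n, and let M_1 = (1/n)∑ R_i. Then the variance of x ↦ ∑ R_i x_i under μ equals (1/(n(n+1)))·∑_{i=1}^n (R_i − M_1)^2, i.e. it equals Var(R)/(n+1) where Var(R) is the biased sample variance of R. -/
open MeasureTheory

namespace PRV

abbrev E (n : ℕ) := EuclideanSpace ℝ (Fin n)

def S (n : ℕ) : E n →ₗ[ℝ] ℝ where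
  toFun x := ∑ i, x i
  map_add' x y := by simp [Finset.sum_add_distrib]
  map_smul' c x := by simp [Finset.mul_sum]

abbrev V (n : ℕ) : Submodule ℝ (E n) := LinearMap.ker (S n)

noncomputable def c (n : ℕ) : E n := WithLp.toLp 2 (fun _ => (1 / n : ℝ))

noncomputable def ι (n : ℕ) (v : V n) : E n := (v : E n) + c n

def Δ (n : ℕ) : Set (E n) := {x | (∀ i, 0 ≤ x i) ∧ ∑ i, x i = 1}

noncomputable def ν (n : ℕ) : Measure (E n) := Measure.map (ι n) (μH[Module.finrank ℝ (V n)])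

lemma S_apply (n : ℕ) (x : E n) : S n x = ∑ i, x i := rfl

lemma S_c {n : ℕ} (hn : 1 ≤ n) : S n (c n) = 1 := by
  have : (n : ℝ) ≠ 0 := by positivity
  simp [S_apply, c, this]

lemma isometry_ι (n : ℕ) : Isometry (ι n) := by
  intro x y
  simp [ι, edist_add_right, Subtype.edist_eq]

lemma finrank_V {n : ℕ} (hn : 1 ≤ n) : (Module.finrank ℝ (V n) : ℝ) = (n : ℝ) - 1 := by
  have h := LinearMap.finrank_range_add_finrank_ker (S n)
  have hs : LinearMap.range (S n) = ⊤ := by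
    rw [LinearMap.range_eq_top]
    intro t
    exact ⟨t • c n, by simp [S_c hn]⟩
  rw [hs] at h
  simp at h
  have : (n : ℝ) = 1 + Module.finrank ℝ (V n) := by exact_mod_cast h.symm
  rw [this]; ring

lemma Δ_subset {n : ℕ} (hn : 1 ≤ n) : Δ n ⊆ Set.range (ι n) := by
  intro x hx
  refine ⟨⟨x - c n, ?_⟩, by simp [ι]⟩
  rw [LinearMap.mem_ker, map_sub, S_c hn, S_apply, hx.2, sub_self]

lemma isClosed_Δ (n : ℕ) : IsClosed (Δ n) := by
  have h : Δ n = (⋂ i, {x : E n | 0 ≤ x i}) ∩ {x : E n | ∑ i, x i = 1} := by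
    ext x; simp [Δ]
  rw [h]
  apply IsClosed.inter
  · exact isClosed_iInter fun i => isClosed_le continuous_const (by fun_prop)
  · exact isClosed_eq (by fun_prop) continuous_const

lemma isCompact_Δ (n : ℕ) : IsCompact (Δ n) := by
  apply Metric.isCompact_of_isClosed_isBounded (isClosed_Δ n)
  apply (Metric.isBounded_iff_subset_closedBall (0 : E n)).2 ⟨1, ?_⟩
  intro x hx
  rw [mem_closedBall_zero_iff, EuclideanSpace.norm_eq, Real.sqrt_le_one]
  calc ∑ i, ‖x i‖ ^ 2 ≤ ∑ i, x i := by
        apply Finset.sum_le_sum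
        intro i _
        have h1 : x i ≤ 1 := by
          rw [← hx.2]
          exact Finset.single_le_sum (fun j _ => hx.1 j) (Finset.mem_univ i)
        have := hx.1 i
        rw [Real.norm_eq_abs, sq_abs]; nlinarith
    _ = 1 := hx.2

lemma ν_restrict {n : ℕ} (hn : 1 ≤ n) :
    (ν n).restrict (Δ n) = (μH[(n : ℝ) - 1]).restrict (Δ n) := by
  rw [ν, (isometry_ι n).map_hausdorffMeasure (Or.inl (by positivity)), finrank_V hn,
    Measure.restrict_restrict (isClosed_Δ n).measurableSet,
    Set.inter_eq_self_of_subset_left (Δ_subset hn)]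

lemma meas_ι (n : ℕ) : Measurable (ι n) := (isometry_ι n).continuous.measurable

lemma ν_ne_top (n : ℕ) : ν n (Δ n) ≠ ⊤ := by
  rw [ν, Measure.map_apply (meas_ι n) (isClosed_Δ n).measurableSet]
  exact ((isometry_ι n).isClosedEmbedding.isCompact_preimage (isCompact_Δ n)).measure_ne_top

lemma ν_ne_zero {n : ℕ} (hn : 1 ≤ n) : ν n (Δ n) ≠ 0 := by
  rw [ν, Measure.map_apply (meas_ι n) (isClosed_Δ n).measurableSet]
  have ho : IsOpen (⋂ i, {v : V n | 0 < (ι n v) i}) := by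
    apply isOpen_iInter_of_finite
    intro i
    have := (isometry_ι n).continuous
    exact isOpen_lt continuous_const (by fun_prop)
  have h0 : (⋂ i, {v : V n | 0 < (ι n v) i}).Nonempty := by
    refine ⟨0, Set.mem_iInter.2 fun i => ?_⟩
    simp [ι, c]; omega
  refine ne_of_gt (lt_of_lt_of_le (ho.measure_pos _ h0) (measure_mono ?_))
  intro v hv
  refine ⟨fun i => (Set.mem_iInter.1 hv i).le, ?_⟩
  have : S n (ι n v) = 1 := by
    rw [ι, map_add, S_c hn, LinearMap.mem_ker.1 v.2, zero_add]
  exact this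

lemma map_G {n : ℕ} (G : E n →ₗ[ℝ] E n) (hi : Function.Injective G)
    (hS : ∀ x, S n (G x) = S n x) :
    ∃ k : ENNReal, Measure.map G (ν n) = k • ν n := by
  have hm : ∀ x ∈ V n, G x ∈ V n := by
    intro x hx
    rw [LinearMap.mem_ker] at hx ⊢
    rw [hS, hx]
  let T : V n →ₗ[ℝ] V n := G.restrict hm
  have hT : Function.Injective T := by
    intro x y h
    apply Subtype.ext
    apply hi
    exact congrArg Subtype.val h
  have hd : LinearMap.det T ≠ 0 := by
    have := LinearEquiv.isUnit_det' (LinearEquiv.ofInjectiveEndo T hT)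
    exact this.ne_zero
  let t : V n := ⟨G (c n) - c n, by rw [LinearMap.mem_ker, map_sub, hS, sub_self]⟩
  have hG : Measurable G := G.continuous_of_finiteDimensional.measurable
  have hTm : Measurable T := T.continuous_of_finiteDimensional.measurable
  have hcomp : G ∘ ι n = ι n ∘ ((fun v => v + t) ∘ T) := by
    funext v
    simp [ι, T, t]
    abel
  refine ⟨ENNReal.ofReal |(LinearMap.det T)⁻¹|, ?_⟩
  rw [ν, Measure.map_map hG (meas_ι n), hcomp,
    ← Measure.map_map (meas_ι n) ((measurable_add_const t).comp hTm),
    ← Measure.map_map (measurable_add_const t) hTm,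
    Measure.map_linearMap_addHaar_eq_smul_addHaar _ hd, Measure.map_smul,
    map_add_right_eq_self, Measure.map_smul]

lemma diag_null {n : ℕ} {i j : Fin n} (hij : i ≠ j) : ν n {x | x i = x j} = 0 := by
  have hc : IsClosed {x : E n | x i = x j} := isClosed_eq (by fun_prop) (by fun_prop)
  rw [ν, Measure.map_apply (meas_ι n) hc.measurableSet]
  let L : V n →ₗ[ℝ] ℝ :=
    { toFun := fun v => (v : E n) i - (v : E n) j
      map_add' := by intro x y; simp; ring
      map_smul' := by intro r x; simp; ring }
  have : ι n ⁻¹' {x : E n | x i = x j} = (LinearMap.ker L : Set (V n)) := by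
    ext v
    simp [ι, c, L, sub_eq_zero]
  rw [this]
  apply Measure.addHaar_submodule
  intro h
  have hv : EuclideanSpace.single i (1 : ℝ) - EuclideanSpace.single j (1 : ℝ) ∈ V n := by
    rw [LinearMap.mem_ker]
    simp [S_apply, Finset.sum_sub_distrib]
  have h2 : (⟨_, hv⟩ : V n) ∈ LinearMap.ker L := by rw [h]; trivial
  rw [LinearMap.mem_ker] at h2
  simp [L, hij, hij.symm] at h2

lemma intOn {n : ℕ} {f : E n → ℝ} (hf : Continuous f) {A : Set (E n)} (hA : A ⊆ Δ n) :
    IntegrableOn f A (ν n) := by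
  have : IsFiniteMeasure ((ν n).restrict (Δ n)) := ⟨by
    rw [Measure.restrict_apply_univ]; exact (ν_ne_top n).lt_top⟩
  refine IntegrableOn.mono_set ?_ hA
  obtain ⟨C, hC⟩ := (isCompact_Δ n).exists_bound_of_continuousOn hf.continuousOn
  refine Integrable.of_bound (C := C) hf.aestronglyMeasurable ?_
  exact (ae_restrict_iff' (isClosed_Δ n).measurableSet).2 (Filter.Eventually.of_forall hC)

lemma int_G {n : ℕ} (G : E n →ₗ[ℝ] E n) (hi : Function.Injective G)
    (hS : ∀ x, S n (G x) = S n x) :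
    ∃ k : ℝ, ∀ (A : Set (E n)) (f : E n → ℝ), MeasurableSet A → Continuous f →
      ∫ x in G ⁻¹' A, f (G x) ∂(ν n) = k * ∫ x in A, f x ∂(ν n) := by
  obtain ⟨k, hk⟩ := map_G G hi hS
  have hG : Measurable G := G.continuous_of_finiteDimensional.measurable
  refine ⟨k.toReal, fun A f hA hf => ?_⟩
  rw [← setIntegral_map hA hf.aestronglyMeasurable hG.aemeasurable, hk, Measure.restrict_smul,
    integral_smul_measure, smul_eq_mul]

lemma vol_ne {n : ℕ} (hn : 1 ≤ n) : ∫ _x in Δ n, (1 : ℝ) ∂(ν n) ≠ 0 := by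
  simp [Measure.real, ENNReal.toReal_eq_zero_iff, ν_ne_zero hn, ν_ne_top]

/-- swap -/
def W {n : ℕ} (i j : Fin n) : E n →ₗ[ℝ] E n where
  toFun x := WithLp.toLp 2 (fun l => x (Equiv.swap i j l))
  map_add' x y := by ext; simp
  map_smul' r x := by ext; simp

lemma W_apply {n : ℕ} (i j l : Fin n) (x : E n) : W i j x l = x (Equiv.swap i j l) := rfl

lemma W_W {n : ℕ} (i j : Fin n) (x : E n) : W i j (W i j x) = x := by
  ext l; simp [W_apply]

lemma W_S {n : ℕ} (i j : Fin n) (x : E n) : S n (W i j x) = S n x := by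
  simp only [S_apply, W_apply]
  exact Equiv.sum_comp (Equiv.swap i j) (fun l => x l)

lemma W_memΔ {n : ℕ} (i j : Fin n) (x : E n) (hx : x ∈ Δ n) : W i j x ∈ Δ n :=
  ⟨fun _ => hx.1 _, (W_S i j x).trans hx.2⟩

lemma W_preΔ {n : ℕ} (i j : Fin n) : W i j ⁻¹' Δ n = Δ n := by
  ext x
  refine ⟨fun h => ?_, W_memΔ i j x⟩
  have := W_memΔ i j _ h
  rwa [W_W] at this

lemma int_W {n : ℕ} (hn : 1 ≤ n) (i j : Fin n) (A : Set (E n)) (f : E n → ℝ)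
    (hA : MeasurableSet A) (hf : Continuous f) :
    ∫ x in W i j ⁻¹' A, f (W i j x) ∂(ν n) = ∫ x in A, f x ∂(ν n) := by
  obtain ⟨k, hk⟩ := int_G (W i j) (Function.LeftInverse.injective (W_W i j)) (W_S i j)
  have h1 := hk (Δ n) (fun _ => 1) (isClosed_Δ n).measurableSet continuous_const
  rw [W_preΔ] at h1
  have : k = 1 := by
    have := vol_ne hn
    field_simp at h1
    exact h1.symm
  rw [hk A f hA hf, this, one_mul]

/-- folding map -/
noncomputable def G {n : ℕ} (i j : Fin n) : E n →ₗ[ℝ] E n where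
  toFun x := x + (x j / 2) • (EuclideanSpace.single i (1 : ℝ) - EuclideanSpace.single j (1 : ℝ))
  map_add' x y := by ext; simp; ring
  map_smul' r x := by ext; simp; ring

lemma G_i {n : ℕ} {i j : Fin n} (h : i ≠ j) (x : E n) : G i j x i = x i + x j / 2 := by
  simp [G, h]

lemma G_j {n : ℕ} {i j : Fin n} (h : i ≠ j) (x : E n) : G i j x j = x j / 2 := by
  simp [G, h.symm]; ring

lemma G_o {n : ℕ} {i j l : Fin n} (hi : l ≠ i) (hj : l ≠ j) (x : E n) : G i j x l = x l := by
  simp [G, hi, hj]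

lemma G_S {n : ℕ} (i j : Fin n) (x : E n) : S n (G i j x) = S n x := by
  simp [G, S_apply, Finset.sum_add_distrib, ← Finset.mul_sum, Finset.sum_sub_distrib]

lemma G_inj {n : ℕ} {i j : Fin n} (h : i ≠ j) : Function.Injective (G i j) := by
  intro x y hxy
  have h1 : x j = y j := by
    have := congrArg (fun z : E n => z j) hxy
    simp only [G_j h] at this; linarith
  ext l
  by_cases hj : l = j
  · rw [hj, h1]
  by_cases hi : l = i
  · have := congrArg (fun z : E n => z i) hxy
    simp only [G_i h] at this; rw [hi]; linarith
  · have := congrArg (fun z : E n => z l) hxy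
    simpa only [G_o hi hj] using this

def H {n : ℕ} (i j : Fin n) : Set (E n) := Δ n ∩ {x | x j ≤ x i}

lemma H_meas {n : ℕ} (i j : Fin n) : MeasurableSet (H i j) :=
  ((isClosed_Δ n).inter (isClosed_le (by fun_prop) (by fun_prop))).measurableSet

lemma G_pre {n : ℕ} {i j : Fin n} (h : i ≠ j) : G i j ⁻¹' H i j = Δ n := by
  ext x
  have hS : (∑ l, G i j x l = 1) ↔ ∑ l, x l = 1 := by
    have := G_S i j x
    simp only [S_apply] at this
    rw [this]
  constructor
  · rintro ⟨⟨h1, h2⟩, h3⟩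
    simp only [Set.mem_ofPred_eq, G_i h, G_j h] at h3
    refine ⟨fun l => ?_, hS.1 h2⟩
    by_cases hj : l = j
    · have := h1 j; rw [G_j h] at this; rw [hj]; linarith
    by_cases hi : l = i
    · rw [hi]; linarith
    · have := h1 l; rwa [G_o hi hj] at this
  · rintro ⟨h1, h2⟩
    have hi' := h1 i
    have hj' := h1 j
    refine ⟨⟨fun l => ?_, hS.2 h2⟩, ?_⟩
    · by_cases hj : l = j
      · rw [hj, G_j h]; linarith
      by_cases hi : l = i
      · rw [hi, G_i h]; linarith
      · rw [G_o hi hj]; exact h1 l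
    · simp only [Set.mem_ofPred_eq, G_i h, G_j h]; linarith

lemma half {n : ℕ} (hn : 1 ≤ n) {i j : Fin n} (h : i ≠ j) (f : E n → ℝ) (hf : Continuous f)
    (hs : ∀ x, f (W i j x) = f x) :
    ∫ x in Δ n, f x ∂(ν n) = 2 * ∫ x in H i j, f x ∂(ν n) := by
  have hU : Δ n = H i j ∪ H j i := by
    ext x
    simp only [H, Set.mem_union, Set.mem_inter_iff, Set.mem_ofPred_eq, ← and_or_left]
    simp [le_total]
  have hd : AEDisjoint (ν n) (H i j) (H j i) := by
    refine measure_mono_null ?_ (diag_null h)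
    rintro x ⟨h1, h2⟩
    exact le_antisymm h2.2 h1.2
  have hW : W i j ⁻¹' H i j = H j i := by
    rw [H, Set.preimage_inter, W_preΔ]
    ext x
    simp [H, W_apply]
  have := int_W hn i j (H i j) f (H_meas i j) hf
  rw [hW] at this
  simp only [hs] at this
  have key := setIntegral_union₀ hd (H_meas j i).nullMeasurableSet
    (intOn hf (A := H i j) Set.inter_subset_left) (intOn hf (A := H j i) Set.inter_subset_left)
  rw [← hU] at key
  rw [key, this]; ring

lemma fold {n : ℕ} (hn : 1 ≤ n) {i j : Fin n} (h : i ≠ j) (f : E n → ℝ) (hf : Continuous f)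
    (hs : ∀ x, f (W i j x) = f x) :
    ∫ x in Δ n, f (G i j x) ∂(ν n) = ∫ x in Δ n, f x ∂(ν n) := by
  obtain ⟨k, hk⟩ := int_G (G i j) (G_inj h) (G_S i j)
  have h1 := hk (H i j) (fun _ => 1) (H_meas i j) continuous_const
  have h2 := half hn h (fun _ => 1) continuous_const (fun _ => rfl)
  have h3 := hk (H i j) f (H_meas i j) hf
  have h4 := half hn h f hf hs
  have hv := vol_ne hn
  rw [G_pre h] at h1 h3
  have : k = 2 := by
    rw [h2] at h1
    have h5 : ∫ x in H i j, (1 : ℝ) ∂(ν n) ≠ 0 := by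
      intro h6; rw [h6] at h2; apply hv; rw [h2]; ring
    exact (mul_right_cancel₀ h5 h1).symm
  rw [h3, h4, this]

lemma diagEq {n : ℕ} (hn : 1 ≤ n) (i j : Fin n) :
    ∫ x in Δ n, x i ^ 2 ∂(ν n) = ∫ x in Δ n, x j ^ 2 ∂(ν n) := by
  have := int_W hn i j (Δ n) (fun x => x j ^ 2) (isClosed_Δ n).measurableSet (by fun_prop)
  rw [W_preΔ] at this
  simpa [W_apply] using this

lemma offdiag {n : ℕ} (hn : 1 ≤ n) {i j : Fin n} (h : i ≠ j) :
    ∫ x in Δ n, x i * x j ∂(ν n) = (∫ x in Δ n, x i ^ 2 ∂(ν n)) / 2 := by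
  have h1 := fold hn h (fun x => x i * x j) (by fun_prop)
    (by intro x; simp [W_apply, mul_comm])
  simp only [G_i h, G_j h] at h1
  have h2 : ∫ x in Δ n, (x i + x j / 2) * (x j / 2) ∂(ν n)
      = (1 / 2) * ∫ x in Δ n, x i * x j ∂(ν n) + (1 / 4) * ∫ x in Δ n, x j ^ 2 ∂(ν n) := by
    rw [← integral_const_mul, ← integral_const_mul, ← integral_add]
    · congr 1; funext x; ring
    · exact intOn (f := fun x => 1 / 2 * (x i * x j)) (by fun_prop) subset_rfl
    · exact intOn (f := fun x => 1 / 4 * (x j ^ 2)) (by fun_prop) subset_rfl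
  rw [h2, diagEq hn j i] at h1
  linarith

lemma quad {n : ℕ} (hn : 1 ≤ n) (i₀ : Fin n) (r : Fin n → ℝ) :
    ∫ x in Δ n, (∑ i, r i * x i) ^ 2 ∂(ν n)
      = (∫ x in Δ n, x i₀ ^ 2 ∂(ν n)) / 2 * (∑ i, r i ^ 2 + (∑ i, r i) ^ 2) := by
  have hexp : ∀ x : E n, (∑ i, r i * x i) ^ 2 = ∑ i, ∑ j, (r i * r j) * (x i * x j) := by
    intro x
    rw [sq, Finset.sum_mul_sum]
    exact Finset.sum_congr rfl fun i _ => Finset.sum_congr rfl fun j _ => by ring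
  simp only [hexp]
  set a := ∫ x in Δ n, x i₀ ^ 2 ∂(ν n) with ha
  have hE : ∀ i j, ∫ x in Δ n, x i * x j ∂(ν n) = a / 2 * (1 + if i = j then 1 else 0) := by
    intro i j
    by_cases h : i = j
    · subst h
      simp only [← sq]
      rw [diagEq hn i i₀, ← ha]; simp; ring
    · rw [offdiag hn h, diagEq hn i i₀, ← ha]; simp [h]
  rw [integral_finsetSum]
  · have : ∀ i, ∫ x in Δ n, ∑ j, (r i * r j) * (x i * x j) ∂(ν n)
        = a / 2 * (r i ^ 2 + r i * ∑ j, r j) := by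
      intro i
      rw [integral_finsetSum]
      · simp only [integral_const_mul, hE]
        have : ∀ j, r i * r j * (a / 2 * (1 + if i = j then (1 : ℝ) else 0))
          = a / 2 * (r i * r j) + if i = j then a / 2 * (r i * r j) else 0 := by
          intro j; split_ifs <;> ring
        simp only [this, Finset.sum_add_distrib, Finset.sum_ite_eq, Finset.mem_univ, if_true,
          ← Finset.mul_sum]
        ring
      · intro j _
        exact intOn (f := fun x => (r i * r j) * (x i * x j)) (by fun_prop) subset_rfl
    simp only [this, ← Finset.mul_sum, Finset.sum_add_distrib, ← Finset.sum_mul]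
    ring
  · intro i _
    exact intOn (f := fun x => ∑ j, (r i * r j) * (x i * x j)) (by fun_prop) subset_rfl

end PRV

theorem portfolio_return_variance (n : ℕ) (hn : 1 ≤ n) (R : Fin n → ℝ) :
    let Δ : Set (EuclideanSpace ℝ (Fin n)) := {x | (∀ i, 0 ≤ x i) ∧ ∑ i, x i = 1}
    let μ0 : Measure (EuclideanSpace ℝ (Fin n)) := (μH[(n : ℝ) - 1]).restrict Δ
    let μ : Measure (EuclideanSpace ℝ (Fin n)) := (μ0 Set.univ)⁻¹ • μ0
    let M₁ : ℝ := (1 / n) * ∑ i, R i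
    (∫ x, (∑ i, R i * x i - M₁) ^ 2 ∂μ)
      = (1 / (n * (n + 1))) * ∑ i, (R i - M₁) ^ 2 := by
  intro Δ μ0 μ M₁
  have hμ0 : μ0 = (PRV.ν n).restrict (PRV.Δ n) := (PRV.ν_restrict hn).symm
  have hn0 : (n : ℝ) ≠ 0 := by positivity
  let i₀ : Fin n := ⟨0, hn⟩
  have hm := (PRV.isClosed_Δ n).measurableSet
  have q1 := PRV.quad hn i₀ (fun _ => 1)
  have q2 := PRV.quad hn i₀ (fun i => R i - M₁)
  have e1 : ∫ x in PRV.Δ n, (∑ i, 1 * x i) ^ 2 ∂(PRV.ν n) = ∫ x in PRV.Δ n, 1 ∂(PRV.ν n) := by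
    refine setIntegral_congr_fun hm fun x hx => ?_
    simp [hx.2]
  have e2 : ∫ x in PRV.Δ n, (∑ i, (R i - M₁) * x i) ^ 2 ∂(PRV.ν n)
      = ∫ x in PRV.Δ n, (∑ i, R i * x i - M₁) ^ 2 ∂(PRV.ν n) := by
    refine setIntegral_congr_fun hm fun x hx => ?_
    simp [sub_mul, Finset.sum_sub_distrib, ← Finset.mul_sum, hx.2]
  have hr : ∑ i, (R i - M₁) = 0 := by
    simp [M₁, Finset.sum_sub_distrib]; field_simp; ring
  have hv := PRV.vol_ne hn
  rw [e1] at q1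
  rw [e2, hr] at q2
  have hc : ((μ0 Set.univ)⁻¹).toReal = (∫ x in PRV.Δ n, (1 : ℝ) ∂(PRV.ν n))⁻¹ := by
    rw [hμ0, Measure.restrict_apply_univ]
    simp [Measure.real]
  rw [integral_smul_measure, hc, hμ0, q2, smul_eq_mul]
  rw [q1] at hv ⊢
  simp only [one_pow, Finset.sum_const, Finset.card_univ, Fintype.card_fin, nsmul_eq_mul,
    mul_one] at hv ⊢
  have ha : (∫ x in PRV.Δ n, x i₀ ^ 2 ∂(PRV.ν n)) ≠ 0 := by
    intro h; apply hv; rw [h]; ring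
  have : (n : ℝ) + 1 ≠ 0 := by positivity
  have : (n : ℝ) + n ^ 2 ≠ 0 := by positivity
  field_simp
  ring
end

section
/- Let μ be the uniform probability measure on the standard simplex Δ^{n-1} ⊂ ℝ^n, R ∈ ℝ^n, and M_1 = (1/n)∑ R_i. Then the third central moment of x ↦ ∑ R_i x_i under μ equals (2/(n(n+1)(n+2)))·∑_{i=1}^n (R_i − M_1)^3. -/
open MeasureTheory
open scoped NNReal ENNReal

/-- The standard simplex. -/
def PSimplex (m : ℕ) : Set (EuclideanSpace ℝ (Fin (m + 1))) :=
  {x | (∀ i, 0 ≤ x i) ∧ ∑ i, x i = 1}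

/-- The corner simplex. -/
def PCorner (m : ℕ) : Set (Fin m → ℝ) := {y | (∀ j, 0 ≤ y j) ∧ ∑ j, y j ≤ 1}

/-- Linear part of the chart. -/
noncomputable def pLin {m : ℕ} (i : Fin (m + 1)) :
    (Fin m → ℝ) →ₗ[ℝ] EuclideanSpace ℝ (Fin (m + 1)) where
  toFun y := WithLp.toLp 2 (i.insertNth (α := fun _ => ℝ) (-∑ j, y j) y)
  map_add' y z := by
    ext k
    refine Fin.succAboveCases i ?_ (fun j => ?_) k
    · simp [Finset.sum_add_distrib]; ring
    · simp
  map_smul' c z := by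
    ext k
    refine Fin.succAboveCases i ?_ (fun j => ?_) k
    · simp [Finset.mul_sum]
    · simp

/-- The affine chart. -/
noncomputable def pChart {m : ℕ} (i : Fin (m + 1)) (y : Fin m → ℝ) :
    EuclideanSpace ℝ (Fin (m + 1)) := EuclideanSpace.single i 1 + pLin i y

theorem pLin_same {m : ℕ} (i : Fin (m + 1)) (y : Fin m → ℝ) :
    pLin i y i = - ∑ j, y j := by
  simp [pLin]

theorem pLin_succAbove {m : ℕ} (i : Fin (m + 1)) (y : Fin m → ℝ) (j : Fin m) :
    pLin i y (i.succAbove j) = y j := by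
  simp [pLin]

theorem pChart_same {m : ℕ} (i : Fin (m + 1)) (y : Fin m → ℝ) :
    pChart i y i = 1 - ∑ j, y j := by
  simp [pChart, pLin_same]; ring

theorem pChart_succAbove {m : ℕ} (i : Fin (m + 1)) (y : Fin m → ℝ) (j : Fin m) :
    pChart i y (i.succAbove j) = y j := by
  simp [pChart, pLin_succAbove, Fin.succAbove_ne]

theorem pLin_ker {m : ℕ} (i : Fin (m + 1)) : LinearMap.ker (pLin i) = ⊥ := by
  rw [LinearMap.ker_eq_bot']
  intro y hy
  ext j
  rw [← pLin_succAbove i y j, hy]; rfl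

theorem pChart_embedding {m : ℕ} (i : Fin (m + 1)) : MeasurableEmbedding (pChart i) := by
  have hc : Continuous (pChart i) :=
    continuous_const.add (pLin i).continuous_of_finiteDimensional
  refine hc.measurableEmbedding ?_
  intro y z h
  ext j
  rw [← pChart_succAbove i y j, h, pChart_succAbove]

theorem pChart_preimage {m : ℕ} (i : Fin (m + 1)) : pChart i ⁻¹' PSimplex m = PCorner m := by
  ext y
  simp only [PSimplex, PCorner, Set.mem_preimage, Set.mem_ofPred_eq,
    Fin.sum_univ_succAbove _ i, Fin.forall_iff_succAbove i, pChart_same, pChart_succAbove]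
  constructor
  · rintro ⟨⟨h1, h2⟩, -⟩; exact ⟨h2, by linarith⟩
  · rintro ⟨h1, h2⟩; exact ⟨⟨by linarith, h1⟩, by ring⟩

theorem pSimplex_range {m : ℕ} (i : Fin (m + 1)) : PSimplex m ⊆ Set.range (pChart i) := by
  intro x hx
  refine ⟨fun j => x (i.succAbove j), ?_⟩
  have h := hx.2
  rw [Fin.sum_univ_succAbove _ i] at h
  ext k
  refine Fin.succAboveCases i ?_ (fun j => ?_) k
  · rw [pChart_same]; linarith
  · rw [pChart_succAbove]

theorem pSimplex_measurable (m : ℕ) : MeasurableSet (PSimplex m) := by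
  have : IsClosed (PSimplex m) := by
    have h1 : PSimplex m = (⋂ i, {x | 0 ≤ x i}) ∩ {x | ∑ i, x i = 1} := by
      ext x; simp [PSimplex]
    rw [h1]
    refine (isClosed_iInter fun i => isClosed_le (by fun_prop) (by fun_prop)).inter
      (isClosed_eq (by fun_prop) (by fun_prop))
  exact this.measurableSet

theorem pCorner_pos (m : ℕ) : volume (PCorner m) ≠ 0 := by
  let U : Set (Fin m → ℝ) := Set.pi Set.univ fun _ => Set.Ioo 0 (1 / (m + 1 : ℝ))
  have hU : IsOpen U := isOpen_set_pi Set.finite_univ fun _ _ => isOpen_Ioo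
  have hp : (0 : ℝ) < m + 1 := by positivity
  have hne : U.Nonempty := ⟨fun _ => 1 / (m + 1 : ℝ) / 2, fun j _ =>
    ⟨by positivity, half_lt_self (by positivity)⟩⟩
  have hsub : U ⊆ PCorner m := by
    intro y hy
    refine ⟨fun j => (hy j trivial).1.le, ?_⟩
    calc ∑ j, y j ≤ ∑ j : Fin m, 1 / (m + 1 : ℝ) := Finset.sum_le_sum fun j _ => (hy j trivial).2.le
      _ = m / (m + 1 : ℝ) := by simp [div_eq_mul_inv]
      _ ≤ 1 := by rw [div_le_one hp]; linarith
  exact ((hU.measure_pos volume hne).trans_le (measure_mono hsub)).ne'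

theorem pComap {m : ℕ} (i : Fin (m + 1)) :
    ∃ c : ℝ≥0, c ≠ 0 ∧
      Measure.comap (pChart i) (μH[(m : ℝ)]) = c • (volume : Measure (Fin m → ℝ)) := by
  have hemb := pChart_embedding i
  set ν := Measure.comap (pChart i) (μH[(m : ℝ)]) with hν
  have hνs : ∀ s, ν s = μH[(m : ℝ)] (pLin i '' s) := by
    intro s
    rw [hν, hemb.comap_apply]
    have : pChart i '' s = (IsometryEquiv.addLeft (EuclideanSpace.single i (1 : ℝ))) ''
        (pLin i '' s) := by
      rw [Set.image_image]; rfl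
    rw [this, IsometryEquiv.hausdorffMeasure_image]
  have hvol : (μH[(m : ℝ)] : Measure (Fin m → ℝ)) = volume := by
    have := hausdorffMeasure_pi_real (ι := Fin m)
    simpa using this
  have hm : (0 : ℝ) ≤ m := Nat.cast_nonneg m
  have hinv : ν.IsAddLeftInvariant := by
    refine ⟨fun g => ?_⟩
    ext s hs
    rw [Measure.map_apply (measurable_const_add g) hs, hνs, hνs,
      ← IsometryEquiv.hausdorffMeasure_image (IsometryEquiv.addLeft (pLin i g))
        (m : ℝ) (pLin i '' ((g + ·) ⁻¹' s))]
    congr 1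
    ext x
    simp only [Set.mem_image, Set.mem_preimage]
    constructor
    · rintro ⟨_, ⟨y, hy, rfl⟩, rfl⟩
      exact ⟨g + y, hy, by simp⟩
    · rintro ⟨y, hy, rfl⟩
      exact ⟨pLin i (-g + y), ⟨-g + y, by simpa using hy, rfl⟩, by
        simp only [IsometryEquiv.addLeft_apply]; rw [← map_add]; simp⟩
  have hfin : IsFiniteMeasureOnCompacts ν := by
    refine ⟨fun K hK => ?_⟩
    rw [hνs]
    have hl := (LinearMap.toContinuousLinearMap (pLin i)).lipschitz
    have h2 := hl.hausdorffMeasure_image_le hm K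
    rw [hvol] at h2
    refine lt_of_le_of_lt h2 ?_
    exact ENNReal.mul_lt_top (ENNReal.rpow_lt_top_of_nonneg hm ENNReal.coe_ne_top) hK.measure_lt_top
  have heq := Measure.isAddLeftInvariant_eq_smul ν (volume : Measure (Fin m → ℝ))
  refine ⟨_, ?_, heq⟩
  intro h0
  rw [h0, zero_smul] at heq
  obtain ⟨K, -, hK⟩ := (pLin i).exists_antilipschitzWith (pLin_ker i)
  have h3 := hK.le_hausdorffMeasure_image hm Set.univ
  rw [← hνs, heq, hvol] at h3
  simp at h3
  exact pCorner_pos m (by rw [h3]; rfl)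

theorem pRestrict {m : ℕ} (i : Fin (m + 1)) :
    ∃ c : ℝ≥0, c ≠ 0 ∧
      (μH[(m : ℝ)]).restrict (PSimplex m) =
        c • Measure.map (pChart i) ((volume : Measure (Fin m → ℝ)).restrict (PCorner m)) := by
  obtain ⟨c, hc, h⟩ := pComap i
  refine ⟨c, hc, ?_⟩
  have hemb := pChart_embedding i
  have h1 := hemb.map_comap (μH[(m : ℝ)])
  rw [h] at h1
  have h2 := congrArg (fun μ => Measure.restrict μ (PSimplex m)) h1
  simp only at h2
  rw [Measure.restrict_restrict (pSimplex_measurable m),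
    Set.inter_eq_left.2 (pSimplex_range i)] at h2
  rw [← h2, hemb.restrict_map, pChart_preimage]
  simp [Measure.restrict_smul, Measure.map_smul]

theorem pCorner_fin (m : ℕ) : volume (PCorner m) < ∞ := by
  refine lt_of_le_of_lt (measure_mono (t := Set.Icc 0 1) ?_) isCompact_Icc.measure_lt_top
  intro y hy
  refine ⟨hy.1, fun j => ?_⟩
  exact (Finset.single_le_sum (f := y) (fun j _ => hy.1 j) (Finset.mem_univ j)).trans hy.2

theorem pSimplex_meas (m : ℕ) :
    μH[(m : ℝ)] (PSimplex m) ≠ 0 ∧ μH[(m : ℝ)] (PSimplex m) ≠ ∞ := by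
  obtain ⟨c, hc, h⟩ := pRestrict (0 : Fin (m + 1))
  have h1 := congrArg (fun μ => μ Set.univ) h
  simp only [Measure.restrict_apply_univ, Measure.smul_apply,
    Measure.map_apply (pChart_embedding (0 : Fin (m + 1))).measurable MeasurableSet.univ,
    Set.preimage_univ] at h1
  rw [h1]
  constructor
  · rw [ENNReal.smul_def, smul_eq_mul]
    exact mul_ne_zero (by simpa using hc) (pCorner_pos m)
  · rw [ENNReal.smul_def, smul_eq_mul]
    exact ENNReal.mul_ne_top ENNReal.coe_ne_top (pCorner_fin m).ne

theorem pSwap {m : ℕ} (i j : Fin (m + 1)) (f : EuclideanSpace ℝ (Fin (m + 1)) → ℝ) :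
    ∫ x in PSimplex m, f (WithLp.toLp 2 fun k => x (Equiv.swap i j k)) ∂μH[(m : ℝ)]
      = ∫ x in PSimplex m, f x ∂μH[(m : ℝ)] := by
  let e := LinearIsometryEquiv.piLpCongrLeft 2 ℝ ℝ (Equiv.swap i j)
  have he : ∀ x, e x = WithLp.toLp 2 fun k => x (Equiv.swap i j k) := by
    intro x
    ext k
    simp [e, LinearIsometryEquiv.piLpCongrLeft_apply, Equiv.piCongrLeft'_apply]
  have hp := e.toIsometryEquiv.measurePreserving_hausdorffMeasure (m : ℝ)
  have hpre : e.toIsometryEquiv ⁻¹' PSimplex m = PSimplex m := by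
    ext x
    have : e.toIsometryEquiv x = WithLp.toLp 2 fun k => x (Equiv.swap i j k) := he x
    simp only [PSimplex, Set.mem_preimage, Set.mem_ofPred_eq, this]
    rw [Equiv.sum_comp (Equiv.swap i j) (fun k => x k)]
    rw [(Equiv.swap i j).forall_congr_left]
    simp
  have := hp.setIntegral_preimage_emb
    e.toIsometryEquiv.toHomeomorph.measurableEmbedding f (PSimplex m)
  rw [hpre] at this
  rw [← this]
  simp_rw [← he]
  rfl

theorem pHalf {m : ℕ} (i : Fin (m + 1)) (j : Fin m)
    (f F : EuclideanSpace ℝ (Fin (m + 1)) → ℝ)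
    (hfF : ∀ z : Fin m → ℝ, f (pChart i (Function.update z j (z j / 2))) = F (pChart i z)) :
    ∫ x in PSimplex m, Set.indicator {x | x (i.succAbove j) ≤ x i} f x ∂μH[(m : ℝ)]
      = 1 / 2 * ∫ x in PSimplex m, F x ∂μH[(m : ℝ)] := by
  obtain ⟨c, hc, h⟩ := pRestrict i
  have hemb := pChart_embedding i
  rw [h, integral_smul_nnreal_measure, integral_smul_nnreal_measure, hemb.integral_map,
    hemb.integral_map]
  have hcm : MeasurableSet (PCorner m) := by
    rw [← pChart_preimage i]; exact hemb.measurable (pSimplex_measurable m)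
  rw [← integral_indicator hcm, ← integral_indicator hcm]
  let D : Fin m → ℝ := Function.update 1 j (1 / 2)
  have hdet : (Matrix.diagonal D).det = 1 / 2 := by
    rw [Matrix.det_diagonal, Finset.prod_update_of_mem (Finset.mem_univ j)]
    simp
  have hD := Real.smul_map_diagonal_volume_pi (D := D) (by rw [hdet]; norm_num)
  have hDl : ∀ z, Matrix.toLin' (Matrix.diagonal D) z = Function.update z j (z j / 2) := by
    intro z
    ext k
    rw [Matrix.toLin'_apply, Matrix.mulVec_diagonal]
    by_cases hk : k = j
    · subst hk; simp [D]; ring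
    · simp [D, hk]
  have hDe : MeasurableEmbedding (Matrix.toLin' (Matrix.diagonal D)) := by
    refine ((Matrix.toLin' (Matrix.diagonal D)).continuous_of_finiteDimensional).measurableEmbedding ?_
    intro y z hyz
    rw [hDl, hDl] at hyz
    ext k
    have := congrFun hyz k
    by_cases hk : k = j
    · subst hk; simpa using this
    · simpa [hk] using this
  have key : ∀ G : (Fin m → ℝ) → ℝ,
      ∫ y, G y = 1 / 2 * ∫ z, G (Function.update z j (z j / 2)) := by
    intro G
    conv_lhs => rw [← hD]
    rw [integral_smul_measure, hDe.integral_map, hdet]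
    simp only [hDl, smul_eq_mul]
    norm_num
  rw [key]
  have hpt : ∀ z : Fin m → ℝ,
      (PCorner m).indicator
        (fun y => Set.indicator {x | x (i.succAbove j) ≤ x i} f (pChart i y))
        (Function.update z j (z j / 2))
      = (PCorner m).indicator (fun y => F (pChart i y)) z := by
    intro z
    classical
    simp only [Set.indicator_apply, hfF]
    rw [← ite_and]
    refine if_congr ?_ rfl rfl
    have hs : ∑ k, Function.update z j (z j / 2) k = ∑ k, z k - z j / 2 := by
      rw [Finset.sum_update_of_mem (Finset.mem_univ j),
        ← Finset.add_sum_erase _ z (Finset.mem_univ j), Finset.sdiff_singleton_eq_erase]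
      ring
    simp only [PCorner, Set.mem_ofPred_eq, pChart_same, pChart_succAbove, hs,
      Function.update_self]
    have hnn : (∀ k, 0 ≤ Function.update z j (z j / 2) k) ↔ ∀ k, 0 ≤ z k := by
      refine forall_congr' fun k => ?_
      by_cases hk : k = j
      · subst hk; simp only [Function.update_self]
        constructor <;> intro h <;> linarith
      · simp [hk]
    rw [hnn]
    constructor
    · rintro ⟨⟨h1, h2⟩, h3⟩; exact ⟨h1, by linarith⟩
    · rintro ⟨h1, h2⟩; exact ⟨⟨h1, by have := h1 j; linarith⟩, by linarith⟩
  simp_rw [hpt]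
  simp only [NNReal.smul_def, smul_eq_mul]
  ring

theorem pInt {m : ℕ} (f : EuclideanSpace ℝ (Fin (m + 1)) → ℝ) (hf : Continuous f) :
    Integrable f ((μH[(m : ℝ)]).restrict (PSimplex m)) := by
  have : IsFiniteMeasure ((μH[(m : ℝ)]).restrict (PSimplex m)) :=
    ⟨by rw [Measure.restrict_apply_univ]; exact (pSimplex_meas m).2.lt_top⟩
  let K : Set (EuclideanSpace ℝ (Fin (m + 1))) := Metric.closedBall 0 (m + 1)
  have hK : IsCompact K := isCompact_closedBall _ _
  obtain ⟨C, hC⟩ := hK.exists_bound_of_continuousOn hf.continuousOn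
  refine Integrable.of_bound hf.aestronglyMeasurable C ?_
  filter_upwards [ae_restrict_mem (pSimplex_measurable m)] with x hx
  refine hC x ?_
  rw [mem_closedBall_zero_iff, EuclideanSpace.norm_eq, Real.sqrt_le_left (by positivity)]
  have hx1 : ∀ i, x i ≤ 1 := fun i =>
    (Finset.single_le_sum (f := fun i => x i) (fun j _ => hx.1 j) (Finset.mem_univ i)).trans hx.2.le
  calc ∑ i, ‖x i‖ ^ 2 ≤ ∑ i : Fin (m + 1), (1 : ℝ) := by
        refine Finset.sum_le_sum fun i _ => ?_
        rw [Real.norm_eq_abs, sq_abs]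
        have := hx.1 i
        have := hx1 i
        nlinarith
    _ = m + 1 := by simp
    _ ≤ _ := by have : (0 : ℝ) ≤ m := Nat.cast_nonneg m
                nlinarith

theorem pFull {m : ℕ} (i j : Fin (m + 1)) (hij : i ≠ j)
    (f F : EuclideanSpace ℝ (Fin (m + 1)) → ℝ) (hf : Continuous f)
    (hsymm : ∀ x : EuclideanSpace ℝ (Fin (m + 1)),
      f (WithLp.toLp 2 fun k => x (Equiv.swap i j k)) = f x)
    (hzero : ∀ x, x i = x j → f x = 0)
    (hfF : ∀ x x' : EuclideanSpace ℝ (Fin (m + 1)), x' i = x i + x j / 2 → x' j = x j / 2 →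
      (∀ k, k ≠ i → k ≠ j → x' k = x k) → f x' = F x) :
    ∫ x in PSimplex m, f x ∂μH[(m : ℝ)] = ∫ x in PSimplex m, F x ∂μH[(m : ℝ)] := by
  obtain ⟨j', rfl⟩ := Fin.exists_succAbove_eq hij.symm
  have hh := pHalf i j' f F (by
    intro z
    have hs : ∑ k, Function.update z j' (z j' / 2) k = ∑ k, z k - z j' / 2 := by
      rw [Finset.sum_update_of_mem (Finset.mem_univ j'),
        ← Finset.add_sum_erase _ z (Finset.mem_univ j'), Finset.sdiff_singleton_eq_erase]
      ring
    apply hfF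
    · rw [pChart_same, pChart_same, pChart_succAbove, hs]; ring
    · rw [pChart_succAbove, pChart_succAbove]; simp
    · intro k hki hkj
      obtain ⟨k', rfl⟩ := Fin.exists_succAbove_eq hki
      rw [pChart_succAbove, pChart_succAbove, Function.update_of_ne]
      rintro rfl
      exact hkj rfl)
  set j := i.succAbove j' with hj
  let g := Set.indicator {x : EuclideanSpace ℝ (Fin (m + 1)) | x j ≤ x i} f
  have hA : MeasurableSet {x : EuclideanSpace ℝ (Fin (m + 1)) | x j ≤ x i} :=
    (isClosed_le (by fun_prop) (by fun_prop)).measurableSet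
  have hgi : Integrable g ((μH[(m : ℝ)]).restrict (PSimplex m)) := (pInt f hf).indicator hA
  have hsplit : ∀ x, f x - g x = g (WithLp.toLp 2 fun k => x (Equiv.swap i j k)) := by
    intro x
    classical
    simp only [g, Set.indicator_apply, hsymm, Set.mem_ofPred_eq, Equiv.swap_apply_left,
      Equiv.swap_apply_right]
    rcases lt_trichotomy (x i) (x j) with h | h | h
    · simp [h.le, h.not_ge]
    · simp [hzero x h]
    · simp [h.le, h.not_ge]
  have h1 := pSwap i j g
  simp_rw [← hsplit] at h1
  rw [integral_sub (pInt f hf) hgi] at h1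
  change ∫ x in PSimplex m, g x ∂μH[(m : ℝ)] = _ at hh
  linarith

/-- Third moments. -/
noncomputable def pQ {m : ℕ} (i j k : Fin (m + 1)) : ℝ :=
  ∫ x in PSimplex m, x i * x j * x k ∂μH[(m : ℝ)]

theorem pQ_swap {m : ℕ} (a b i j k : Fin (m + 1)) :
    pQ (Equiv.swap a b i) (Equiv.swap a b j) (Equiv.swap a b k) = pQ i j k :=
  pSwap a b (fun x => x i * x j * x k)

theorem pQ_comm12 {m : ℕ} (i j k : Fin (m + 1)) : pQ i j k = pQ j i k := by
  unfold pQ; congr 1; ext x; ring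

theorem pQ_comm23 {m : ℕ} (i j k : Fin (m + 1)) : pQ i j k = pQ i k j := by
  unfold pQ; congr 1; ext x; ring

theorem pQi {m : ℕ} (i j k : Fin (m + 1)) :
    Integrable (fun x : EuclideanSpace ℝ (Fin (m + 1)) => x i * x j * x k)
      ((μH[(m : ℝ)]).restrict (PSimplex m)) := pInt _ (by fun_prop)

theorem pQ_iii {m : ℕ} (i j : Fin (m + 1)) : pQ i i i = pQ j j j := by
  have := pQ_swap i j j j j
  simpa using this

theorem pQ_iij {m : ℕ} (i j : Fin (m + 1)) (hij : i ≠ j) : pQ i i i = 3 * pQ i i j := by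
  have h := pFull i j hij (fun x => (x i - x j) ^ 2 * (x i + x j))
    (fun x => x i ^ 2 * (x i + x j)) (by fun_prop)
    (by intro x; simp; ring) (by intro x hx; simp [hx])
    (by intro x x' h1 h2 _; simp only [h1, h2]; ring)
  have e1 : ∫ x in PSimplex m, (x i - x j) ^ 2 * (x i + x j) ∂μH[(m : ℝ)]
      = pQ i i i - pQ i i j - pQ j j i + pQ j j j := by
    unfold pQ
    rw [← integral_sub (pQi _ _ _) (pQi _ _ _),
      ← integral_sub (pInt _ ?_) (pQi _ _ _), ← integral_add (pInt _ ?_) (pQi _ _ _)]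
    · congr 1; ext x; ring
    · fun_prop
    · fun_prop
  have e2 : ∫ x in PSimplex m, x i ^ 2 * (x i + x j) ∂μH[(m : ℝ)]
      = pQ i i i + pQ i i j := by
    unfold pQ
    rw [← integral_add (pQi _ _ _) (pQi _ _ _)]
    congr 1; ext x; ring
  rw [e1, e2] at h
  have h3 := pQ_swap i j i i j
  simp only [Equiv.swap_apply_left, Equiv.swap_apply_right] at h3
  have h4 := pQ_iii i j
  linarith

theorem pQ_ijk {m : ℕ} (i j k : Fin (m + 1)) (hij : i ≠ j) (hki : k ≠ i) (hkj : k ≠ j) :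
    pQ i i k = 2 * pQ i j k := by
  have h := pFull i j hij (fun x => (x i - x j) ^ 2 * x k)
    (fun x => x i ^ 2 * x k) (by fun_prop)
    (by intro x; simp [Equiv.swap_apply_of_ne_of_ne hki hkj]; left; ring)
    (by intro x hx; simp [hx])
    (by intro x x' h1 h2 h3; simp only [h1, h2, h3 k hki hkj]; ring)
  have e1 : ∫ x in PSimplex m, (x i - x j) ^ 2 * x k ∂μH[(m : ℝ)]
      = pQ i i k - pQ i j k - pQ i j k + pQ j j k := by
    unfold pQ
    rw [← integral_sub (pQi _ _ _) (pQi _ _ _),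
      ← integral_sub (pInt _ ?_) (pQi _ _ _), ← integral_add (pInt _ ?_) (pQi _ _ _)]
    · congr 1; ext x; ring
    · fun_prop
    · fun_prop
  have e2 : ∫ x in PSimplex m, x i ^ 2 * x k ∂μH[(m : ℝ)] = pQ i i k := by
    unfold pQ
    congr 1; ext x; ring
  rw [e1, e2] at h
  have h3 := pQ_swap i j i i k
  simp only [Equiv.swap_apply_left, Equiv.swap_apply_of_ne_of_ne hki hkj] at h3
  linarith

theorem pQ_eq {m : ℕ} (i j k : Fin (m + 1)) :
    pQ i j k = pQ (0 : Fin (m + 1)) 0 0 / 6 * (1 + (if i = j then 1 else 0)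
      + (if j = k then 1 else 0) + (if i = k then 1 else 0)
      + 2 * (if i = j then (if j = k then 1 else 0) else 0)) := by
  have h0 := pQ_iii i 0
  by_cases hij : i = j
  · subst hij
    by_cases hik : i = k
    · subst hik; simp; linarith
    · have := pQ_iij i k hik
      simp [hik]; linarith
  · by_cases hik : i = k
    · subst hik
      have := pQ_iij i j hij
      have h2 := pQ_comm23 i j i
      simp [hij, Ne.symm hij]; linarith
    · by_cases hjk : j = k
      · subst hjk
        have := pQ_iij j i (Ne.symm hij)
        have h2 := pQ_comm12 i j j
        have h3 := pQ_comm23 j i j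
        have h4 := pQ_iii i j
        simp [hij]; linarith
      · have h1 := pQ_ijk i j k hij (Ne.symm hik) (Ne.symm hjk)
        have h2 := pQ_iij i k hik
        simp [hij, hik, hjk]; linarith

theorem pCube {m : ℕ} (a : Fin (m + 1) → ℝ) :
    ∫ x in PSimplex m, (∑ i, a i * x i) ^ 3 ∂μH[(m : ℝ)]
      = pQ (0 : Fin (m + 1)) 0 0 / 6 *
        ((∑ i, a i) ^ 3 + 3 * (∑ i, a i) * (∑ i, a i ^ 2) + 2 * ∑ i, a i ^ 3) := by
  have e1 : ∀ x : EuclideanSpace ℝ (Fin (m + 1)), (∑ i, a i * x i) ^ 3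
      = ∑ i, ∑ j, ∑ k, a i * a j * a k * (x i * x j * x k) := by
    intro x
    rw [pow_succ, pow_two, Finset.sum_mul_sum, Finset.sum_mul]
    refine Finset.sum_congr rfl fun i _ => ?_
    rw [Finset.sum_mul_sum]
    refine Finset.sum_congr rfl fun j _ => Finset.sum_congr rfl fun k _ => ?_
    ring
  have e2 : ∫ x in PSimplex m, (∑ i, a i * x i) ^ 3 ∂μH[(m : ℝ)]
      = ∑ i, ∑ j, ∑ k, a i * a j * a k * pQ i j k := by
    simp_rw [e1]
    rw [integral_finsetSum _ fun i _ => pInt _ (by fun_prop)]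
    refine Finset.sum_congr rfl fun i _ => ?_
    rw [integral_finsetSum _ fun i _ => pInt _ (by fun_prop)]
    refine Finset.sum_congr rfl fun j _ => ?_
    rw [integral_finsetSum _ fun i _ => pInt _ (by fun_prop)]
    refine Finset.sum_congr rfl fun k _ => ?_
    rw [integral_const_mul]; rfl
  rw [e2]
  generalize hA : pQ (0 : Fin (m + 1)) 0 0 / 6 = A
  have e3 : ∀ i j : Fin (m + 1), ∑ k, a i * a j * a k * pQ i j k
      = A * (a i * a j * (∑ k, a k) + (if i = j then a i * a j * ∑ k, a k else 0)
        + a i * a j ^ 2 + a i ^ 2 * a j + 2 * (if i = j then a i * a j ^ 2 else 0)) := by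
    intro i j
    have : ∀ k, a i * a j * a k * pQ i j k = A * (a i * a j * a k
        + (if i = j then a i * a j * a k else 0)
        + (if j = k then a i * a j * a k else 0) + (if i = k then a i * a j * a k else 0)
        + 2 * (if i = j then (if j = k then a i * a j * a k else 0) else 0)) := by
      intro k
      rw [pQ_eq, hA]
      split_ifs <;> ring
    simp_rw [this]
    rw [← Finset.mul_sum]
    congr 1
    simp only [Finset.sum_add_distrib, ← Finset.mul_sum]
    by_cases hij : i = j
    · subst hij; simp [← Finset.mul_sum]; ring
    · simp [hij]; ring
  have e4 : ∀ i : Fin (m + 1), ∑ j, ∑ k, a i * a j * a k * pQ i j k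
      = A * (a i * (∑ k, a k) ^ 2 + a i ^ 2 * (∑ k, a k)
        + a i * (∑ k, a k ^ 2) + a i ^ 2 * (∑ k, a k) + 2 * a i ^ 3) := by
    intro i
    simp_rw [e3]
    rw [← Finset.mul_sum]
    congr 1
    simp only [Finset.sum_add_distrib, ← Finset.mul_sum, ← Finset.sum_mul]
    simp
    ring
  simp_rw [e4]
  rw [← Finset.mul_sum]
  congr 1
  simp only [Finset.sum_add_distrib, ← Finset.mul_sum, ← Finset.sum_mul]
  ring

theorem portfolio_return_third_moment (n : ℕ) (hn : 1 ≤ n) (R : Fin n → ℝ) :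
    let Δ : Set (EuclideanSpace ℝ (Fin n)) := {x | (∀ i, 0 ≤ x i) ∧ ∑ i, x i = 1}
    let μ0 : Measure (EuclideanSpace ℝ (Fin n)) := (μH[(n : ℝ) - 1]).restrict Δ
    let μ : Measure (EuclideanSpace ℝ (Fin n)) := (μ0 Set.univ)⁻¹ • μ0
    let M₁ : ℝ := (1 / n) * ∑ i, R i
    (∫ x, (∑ i, R i * x i - M₁) ^ 3 ∂μ)
      = (2 / (n * (n + 1) * (n + 2))) * ∑ i, (R i - M₁) ^ 3 := by
  obtain ⟨m, rfl⟩ : ∃ m, n = m + 1 := ⟨n - 1, by omega⟩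
  intro Δ μ0 μ M₁
  have hμ0 : μ0 = (μH[(m : ℝ)]).restrict (PSimplex m) := by
    simp only [μ0, Δ, PSimplex]
    congr 2
    push_cast; ring
  have hmeas := pSimplex_meas m
  have hμ0u : μ0 Set.univ = μH[(m : ℝ)] (PSimplex m) := by
    rw [hμ0, Measure.restrict_apply_univ]
  set V : ℝ := (μH[(m : ℝ)] (PSimplex m)).toReal with hV
  have hVpos : 0 < V := ENNReal.toReal_pos hmeas.1 hmeas.2
  have hM : ∑ i, (R i - M₁) = 0 := by
    simp only [Finset.sum_sub_distrib, Finset.sum_const, Finset.card_univ, Fintype.card_fin, M₁,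
      nsmul_eq_mul]
    have : ((m + 1 : ℕ) : ℝ) ≠ 0 := by positivity
    field_simp
    ring
  have h1 := pCube (m := m) (fun _ => 1)
  have h2 := pCube (fun i => R i - M₁)
  rw [hM] at h2
  have e1 : ∫ x in PSimplex m, (∑ i, (1 : ℝ) * x i) ^ 3 ∂μH[(m : ℝ)] = V := by
    rw [setIntegral_congr_fun (g := fun _ => (1 : ℝ)) (pSimplex_measurable m)]
    · simp [hV, Measure.real]
    · intro x hx
      simp [hx.2]
  have e2 : ∫ x in PSimplex m, (∑ i, (R i - M₁) * x i) ^ 3 ∂μH[(m : ℝ)]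
      = ∫ x in PSimplex m, (∑ i, R i * x i - M₁) ^ 3 ∂μH[(m : ℝ)] := by
    refine setIntegral_congr_fun (pSimplex_measurable m) ?_
    intro x hx
    simp only [sub_mul, Finset.sum_sub_distrib, ← Finset.mul_sum, hx.2, mul_one]
  rw [e1] at h1
  rw [e2] at h2
  have e3 : ∫ x, (∑ i, R i * x i - M₁) ^ 3 ∂μ
      = V⁻¹ * ∫ x in PSimplex m, (∑ i, R i * x i - M₁) ^ 3 ∂μH[(m : ℝ)] := by
    simp only [μ]
    rw [integral_smul_measure, hμ0u, hμ0, ENNReal.toReal_inv, smul_eq_mul]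
  rw [e3, h2]
  simp only [Finset.sum_const, Finset.card_univ, Fintype.card_fin, nsmul_eq_mul, mul_one,
    one_pow] at h1
  generalize pQ (0 : Fin (m + 1)) 0 0 = A at *
  generalize ∑ i, (R i - M₁) ^ 3 = p at *
  set N : ℝ := ((m + 1 : ℕ) : ℝ) with hN
  have hNpos : 0 < N := by rw [hN]; positivity
  have h1' : V = A / 6 * (N * (N + 1) * (N + 2)) := by rw [h1]; ring
  have hAne : A ≠ 0 := by
    rintro rfl
    simp at h1'
    exact hVpos.ne' h1'
  rw [h1']
  field_simp
  ring
end

section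
/- Let μ be the uniform probability measure on the standard simplex Δ^{n-1} ⊂ ℝ^n, R ∈ ℝ^n, and M_1 = (1/n)∑ R_i. Then the fourth central moment of x ↦ ∑ R_i x_i under μ equals (1/(n(n+1)(n+2)(n+3)))·(6∑_{i=1}^n (R_i − M_1)^4 + 3(∑_{i=1}^n (R_i − M_1)^2)^2). -/
open MeasureTheory ProbabilityTheory
open scoped ENNReal

theorem fourth_of_indep {Ω ι : Type*} [DecidableEq ι] [MeasurableSpace Ω] (P : Measure Ω) [IsProbabilityMeasure P]
    (Y : ι → Ω → ℝ) (hY : iIndepFun Y P) (hm : ∀ i, Measurable (Y i))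
    (hL : ∀ i, MemLp (Y i) 4 P) (h1 : ∀ i, ∫ w, Y i w ∂P = 0)
    (h2 : ∀ i, ∫ w, Y i w ^ 2 ∂P = 1) (h4 : ∀ i, ∫ w, Y i w ^ 4 ∂P = 9) (a : ι → ℝ)
    (s : Finset ι) :
    MemLp (fun w => ∑ i ∈ s, a i * Y i w) 4 P ∧ ∫ w, ∑ i ∈ s, a i * Y i w ∂P = 0 ∧
    ∫ w, (∑ i ∈ s, a i * Y i w) ^ 2 ∂P = ∑ i ∈ s, a i ^ 2 ∧
    ∫ w, (∑ i ∈ s, a i * Y i w) ^ 4 ∂P = 6 * ∑ i ∈ s, a i ^ 4 + 3 * (∑ i ∈ s, a i ^ 2) ^ 2 := by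
  have key : ∀ f : Ω → ℝ, MemLp f 4 P → ∀ k : ℕ, k ≤ 4 → Integrable (fun w => f w ^ k) P := by
    intro f hf k hk
    rcases Nat.eq_zero_or_pos k with rfl | hk0
    · simp
    have h : MemLp f k P := hf.mono_exponent (by exact_mod_cast hk)
    have h' := h.integrable_norm_pow hk0.ne'
    refine h'.mono' (hf.1.pow k) ?_
    filter_upwards with w
    simp
  induction s using Finset.induction_on with
  | empty => simp
  | insert j s hj ih =>
    obtain ⟨ihL, ih1, ih2, ih4⟩ := ih
    have hind : IndepFun (fun w => ∑ i ∈ s, a i * Y i w) (Y j) P := by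
      have h := (hY.comp (fun i => if i = j then id else fun x => a i * x) (by
        intro i; split_ifs <;> fun_prop)).indepFun_finsetSum_of_notMem (by
        intro i; split_ifs
        · exact hm i
        · exact (hm i).const_mul _) hj
      simp only [if_true, Function.id_comp] at h
      convert h using 1
      ext w
      rw [Finset.sum_apply]
      refine Finset.sum_congr rfl fun i hi => ?_
      have : i ≠ j := fun h => hj (h ▸ hi)
      simp [this]
    set S : Ω → ℝ := fun w => ∑ i ∈ s, a i * Y i w with hS
    have hp : ∀ p q : ℕ, p ≤ 4 → q ≤ 4 → Integrable (fun w => S w ^ p * Y j w ^ q) P := by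
      intro p q h h'
      exact (hind.comp (measurable_id.pow_const p) (measurable_id.pow_const q)).integrable_mul
        (key _ ihL p h) (key _ (hL j) q h')
    have hE : ∀ p q : ℕ, p ≤ 4 → q ≤ 4 → ∫ w, S w ^ p * Y j w ^ q ∂P =
        (∫ w, S w ^ p ∂P) * ∫ w, Y j w ^ q ∂P := by
      intro p q h h'
      exact (hind.comp (measurable_id.pow_const p)
        (measurable_id.pow_const q)).integral_fun_mul_eq_mul_integral
        (key _ ihL p h).1 (key _ (hL j) q h').1
    have hsum : (fun w => ∑ i ∈ insert j s, a i * Y i w) = fun w => a j * Y j w + S w := by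
      ext w; rw [Finset.sum_insert hj]
    have hsum' : ∀ w, ∑ i ∈ insert j s, a i * Y i w = a j * Y j w + S w := fun w => congrFun hsum w
    have hi1 : Integrable S P := by simpa using key _ ihL 1 (by norm_num)
    have hi2 : Integrable (Y j) P := by simpa using key _ (hL j) 1 (by norm_num)
    refine ⟨?_, ?_, ?_, ?_⟩
    · rw [hsum]; exact ((hL j).const_mul _).add ihL
    · simp only [hsum']
      rw [integral_add (hi2.const_mul _) hi1, integral_const_mul, h1, ih1]; simp
    · simp only [hsum', Finset.sum_insert hj]
      have e : ∀ w, (a j * Y j w + S w) ^ 2 = a j ^ 2 * (S w ^ 0 * Y j w ^ 2)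
        + 2 * a j * (S w ^ 1 * Y j w ^ 1) + 1 * (S w ^ 2 * Y j w ^ 0) := by intro w; ring
      simp only [e]
      have I := fun p q h h' => hp p q h h'
      rw [integral_add, integral_add]
      · simp only [integral_const_mul]
        rw [hE 0 2, hE 1 1, hE 2 0] <;> try norm_num
        rw [h1, h2, ih2]; ring
      all_goals
        repeat' apply Integrable.add
        all_goals exact (hp _ _ (by norm_num) (by norm_num)).const_mul _
    · simp only [hsum', Finset.sum_insert hj]
      have e : ∀ w, (a j * Y j w + S w) ^ 4 = a j ^ 4 * (S w ^ 0 * Y j w ^ 4)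
        + 4 * a j ^ 3 * (S w ^ 1 * Y j w ^ 3) + 6 * a j ^ 2 * (S w ^ 2 * Y j w ^ 2)
        + 4 * a j * (S w ^ 3 * Y j w ^ 1) + 1 * (S w ^ 4 * Y j w ^ 0) := by intro w; ring
      simp only [e]
      rw [integral_add, integral_add, integral_add, integral_add]
      · simp only [integral_const_mul]
        rw [hE 0 4, hE 1 3, hE 2 2, hE 3 1, hE 4 0] <;> try norm_num
        rw [h1, h2, h4, ih1, ih2, ih4]; ring
      all_goals
        repeat' apply Integrable.add
        all_goals exact (hp _ _ (by norm_num) (by norm_num)).const_mul _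

noncomputable def expD (t : ℝ) : ℝ≥0∞ := (Set.Ici (0:ℝ)).indicator (fun t => ENNReal.ofReal (Real.exp (-t))) t

theorem measurable_expD : Measurable expD := by
  unfold expD
  exact Measurable.indicator (by fun_prop) measurableSet_Ici

theorem lint_gamma (k : ℕ) : ∫⁻ t, ENNReal.ofReal (t ^ k) * expD t = (k.factorial : ℝ≥0∞) := by
  have e : ∀ t, ENNReal.ofReal (t ^ k) * expD t =
      (Set.Ici (0:ℝ)).indicator (fun t => ENNReal.ofReal (Real.exp (-t) * t ^ ((k + 1 : ℝ) - 1))) t := by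
    intro t
    unfold expD
    by_cases h : t ∈ Set.Ici (0:ℝ)
    · simp only [Set.indicator_of_mem h]
      rw [← ENNReal.ofReal_mul (pow_nonneg h _), mul_comm]
      simp
    · simp [Set.indicator_of_notMem h]
  simp only [e]
  rw [lintegral_indicator measurableSet_Ici, ← restrict_Ioi_eq_restrict_Ici, ← ofReal_integral_eq_lintegral_ofReal]
  · rw [← Real.Gamma_eq_integral (by positivity), Real.Gamma_nat_eq_factorial]
    simp
  · exact Real.GammaIntegral_convergent (by positivity)
  · filter_upwards [ae_restrict_mem measurableSet_Ioi] with t ht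
    have : 0 < t := ht
    positivity

noncomputable def expM : Measure ℝ := volume.withDensity expD

instance : IsProbabilityMeasure expM := ⟨by
  have := lint_gamma 0
  simp at this
  simp [expM, this]⟩

theorem expM_pos : ∀ᵐ t ∂expM, 0 ≤ t := by
  rw [expM, ae_withDensity_iff measurable_expD]
  filter_upwards with t ht
  by_contra h
  exact ht (Set.indicator_of_notMem h _)

theorem expM_lint (k : ℕ) : ∫⁻ t, ENNReal.ofReal (t ^ k) ∂expM = (k.factorial : ℝ≥0∞) := by
  rw [expM, lintegral_withDensity_eq_lintegral_mul _ measurable_expD (by fun_prop), ← lint_gamma k]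
  simp [mul_comm]

theorem expM_integrable (k : ℕ) : Integrable (fun t => t ^ k) expM := by
  refine ⟨by fun_prop, ?_⟩
  rw [hasFiniteIntegral_iff_ofReal, expM_lint]
  · exact ENNReal.natCast_lt_top _
  · filter_upwards [expM_pos] with t ht
    exact pow_nonneg ht k

theorem expM_int (k : ℕ) : ∫ t, t ^ k ∂expM = k.factorial := by
  rw [integral_eq_lintegral_of_nonneg_ae, expM_lint]
  · simp
  · filter_upwards [expM_pos] with t ht
    exact pow_nonneg ht k
  · fun_prop

theorem expM_memLp : MemLp (fun t : ℝ => t - 1) 4 expM := by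
  refine MemLp.sub ?_ (memLp_const _)
  have : MemLp (fun t : ℝ => t) (4:ℕ) expM := by
    rw [← integrable_norm_rpow_iff (by fun_prop) (by norm_num) (by norm_num)]
    refine (expM_integrable 4).congr ?_
    filter_upwards [expM_pos] with t ht
    have h4 : ((4:ℕ):ℝ≥0∞).toReal = ((4:ℕ):ℝ) := by simp
    rw [h4, Real.rpow_natCast]
    simp [abs_of_nonneg ht]
  exact_mod_cast this

theorem expM_1 : ∫ t, (t - 1) ∂expM = 0 := by
  rw [integral_sub (by simpa using expM_integrable 1) (by simp)]
  have := expM_int 1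
  simp at this
  simp [this]

theorem expM_2 : ∫ t, (t - 1)^2 ∂expM = 1 := by
  have e : ∀ t : ℝ, (t - 1)^2 = 1 * t ^ 2 + (-2) * t ^ 1 + 1 * t ^ 0 := by intro t; ring
  simp only [e]
  rw [integral_add, integral_add]
  · simp only [integral_const_mul, expM_int]; norm_num [Nat.factorial]
  all_goals
    repeat' apply Integrable.add
    all_goals exact (expM_integrable _).const_mul _

theorem expM_4 : ∫ t, (t - 1)^4 ∂expM = 9 := by
  have e : ∀ t : ℝ, (t - 1)^4 = 1 * t ^ 4 + (-4) * t ^ 3 + 6 * t ^ 2 + (-4) * t ^ 1 + 1 * t ^ 0 := by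
    intro t; ring
  simp only [e]
  rw [integral_add, integral_add, integral_add, integral_add]
  · simp only [integral_const_mul, expM_int]; norm_num [Nat.factorial]
  all_goals
    repeat' apply Integrable.add
    all_goals exact (expM_integrable _).const_mul _

theorem pi_fourth {n : ℕ} (a : Fin n → ℝ) (ha : ∑ i, a i = 0) :
    ∫⁻ x, ENNReal.ofReal ((∑ i, a i * x i) ^ 4) ∂(Measure.pi fun _ : Fin n => expM) =
      ENNReal.ofReal (6 * ∑ i, a i ^ 4 + 3 * (∑ i, a i ^ 2) ^ 2) := by
  have h := fourth_of_indep (Measure.pi fun _ : Fin n => expM) (fun i x => x i - 1)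
    (iIndepFun_pi (μ := fun _ : Fin n => expM) (X := fun _ t => t - 1) (fun i => by fun_prop)) (fun i => by fun_prop)
    (fun i => expM_memLp.comp_measurePreserving (measurePreserving_eval (fun _ : Fin n => expM) i))
    (fun i => by
      rw [← expM_1]
      exact integral_comp_eval (μ := fun _ : Fin n => expM) (f := fun t : ℝ => t - 1) (by fun_prop))
    (fun i => by
      refine Eq.trans ?_ expM_2
      exact integral_comp_eval (μ := fun _ : Fin n => expM) (f := fun t : ℝ => (t - 1)^2) (by fun_prop))
    (fun i => by
      rw [← expM_4]
      exact integral_comp_eval (μ := fun _ : Fin n => expM) (f := fun t : ℝ => (t - 1)^4) (by fun_prop))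
    a Finset.univ
  obtain ⟨hL, -, -, h4⟩ := h
  have e : ∀ x : Fin n → ℝ, ∑ i, a i * (x i - 1) = ∑ i, a i * x i := by
    intro x
    simp [mul_sub, ha]
  simp only [e] at hL h4
  rw [← h4, ofReal_integral_eq_lintegral_ofReal]
  · have h' := hL.integrable_norm_pow (by norm_num : (4:ℕ) ≠ 0)
    refine h'.mono' (hL.1.pow 4) ?_
    filter_upwards with w
    simp
  · filter_upwards with x
    positivity

theorem lint_prod_fin {n : ℕ} (f : Fin n → ℝ → ℝ≥0∞) (hf : ∀ i, Measurable (f i)) :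
    ∫⁻ x : Fin n → ℝ, ∏ i, f i (x i) = ∏ i, ∫⁻ t, f i t := by
  induction n with
  | zero => simp [volume_pi]
  | succ m ih =>
    rw [← (volume_preserving_piFinSuccAbove (fun _ : Fin (m+1) => ℝ) 0).symm.lintegral_comp
      (by fun_prop), Fin.prod_univ_succ]
    have hp : Measurable (fun x : Fin m → ℝ => ∏ i, f i.succ (x i)) :=
      Finset.measurable_prod _ fun i _ => (hf _).comp (measurable_pi_apply i)
    rw [← ih (fun i => f i.succ) (fun i => hf _), Measure.volume_eq_prod,
      ← lintegral_prod_mul (hf 0).aemeasurable hp.aemeasurable]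
    simp [Fin.prod_univ_succ, MeasurableEquiv.piFinSuccAbove]

theorem pi_expM (n : ℕ) : (Measure.pi fun _ : Fin n => expM) =
    (volume : Measure (Fin n → ℝ)).withDensity (fun x => ∏ i, expD (x i)) := by
  have hm := measurable_expD
  apply Measure.pi_eq
  intro s hs
  have hpi : MeasurableSet (Set.univ.pi s) := MeasurableSet.univ_pi hs
  rw [withDensity_apply _ hpi, ← lintegral_indicator hpi]
  have e : ∀ x : Fin n → ℝ, (Set.univ.pi s).indicator (fun x => ∏ i, expD (x i)) x =
      ∏ i, (s i).indicator expD (x i) := by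
    intro x
    by_cases h : x ∈ Set.univ.pi s
    · rw [Set.indicator_of_mem h]
      exact Finset.prod_congr rfl fun i _ => (Set.indicator_of_mem (h i trivial) _).symm
    · rw [Set.indicator_of_notMem h]
      simp only [Set.mem_univ_pi, not_forall] at h
      obtain ⟨i, hi⟩ := h
      exact (Finset.prod_eq_zero (Finset.mem_univ i) (Set.indicator_of_notMem hi _)).symm
  simp only [e]
  rw [lint_prod_fin _ (fun i => hm.indicator (hs i))]
  refine Finset.prod_congr rfl fun i _ => ?_
  rw [lintegral_indicator (hs i), expM, withDensity_apply _ (hs i)]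

theorem prod_expD {n : ℕ} (x : Fin n → ℝ) : ∏ i, expD (x i) =
    {x : Fin n → ℝ | ∀ i, 0 ≤ x i}.indicator (fun _ => 1) x * expD (∑ i, x i) := by
  by_cases h : ∀ i, 0 ≤ x i
  · rw [Set.indicator_of_mem (by exact h)]
    have hs : 0 ≤ ∑ i, x i := Finset.sum_nonneg fun i _ => h i
    simp only [expD]
    rw [Set.indicator_of_mem (by exact hs), one_mul, ← Finset.sum_neg_distrib, Real.exp_sum,
      ENNReal.ofReal_prod_of_nonneg (fun _ _ => (Real.exp_pos _).le)]
    exact Finset.prod_congr rfl fun i _ => Set.indicator_of_mem (by exact h i) _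
  · rw [Set.indicator_of_notMem (by exact h), zero_mul]
    push Not at h
    obtain ⟨i, hi⟩ := h
    exact (Finset.prod_eq_zero (Finset.mem_univ i) (Set.indicator_of_notMem (by simpa using hi) _))

/-- the affine chart -/
def chart (m : ℕ) (s : ℝ) (y : Fin m → ℝ) : Fin (m+1) → ℝ := Fin.cons (s - ∑ i, y i) y

theorem chart_sum (m : ℕ) (s : ℝ) (y : Fin m → ℝ) : ∑ i, chart m s y i = s := by
  simp [chart, Fin.sum_univ_succ]

theorem measurable_chart (m : ℕ) : Measurable (fun p : (Fin m → ℝ) × ℝ => chart m p.2 p.1) := by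
  rw [measurable_pi_iff]
  intro i
  refine Fin.cases ?_ (fun j => ?_) i <;> simp only [chart, Fin.cons_zero, Fin.cons_succ] <;> fun_prop

theorem lint_cone (m d : ℕ) (g : (Fin (m+1) → ℝ) → ℝ≥0∞) (hg : Measurable g)
    (hd : ∀ s : ℝ, 0 < s → ∀ x, g (s • x) = ENNReal.ofReal (s ^ d) * g x) :
    ∫⁻ x, g x ∂(Measure.pi fun _ : Fin (m+1) => expM) =
      ((m + d).factorial : ℝ≥0∞) *
        ∫⁻ y in {y : Fin m → ℝ | ∀ i, 0 ≤ chart m 1 y i}, g (chart m 1 y) := by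
  have hm := measurable_expD
  set Q : Set (Fin (m+1) → ℝ) := {x | ∀ i, 0 ≤ x i} with hQ
  have hQm : MeasurableSet Q := by
    have : Q = ⋂ i, {x | 0 ≤ x i} := by ext; simp [Q]
    rw [this]
    exact MeasurableSet.iInter fun i => measurableSet_le measurable_const (measurable_pi_apply i)
  set G : (Fin (m+1) → ℝ) → ℝ≥0∞ := Q.indicator g with hG
  have hGm : Measurable G := hg.indicator hQm
  have hGd : ∀ s : ℝ, 0 < s → ∀ x, G (s • x) = ENNReal.ofReal (s ^ d) * G x := by
    intro s hs x
    have : s • x ∈ Q ↔ x ∈ Q := by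
      simp [Q, hs]
    by_cases h : x ∈ Q
    · simp only [G]
      rw [Set.indicator_of_mem h, Set.indicator_of_mem (this.2 h), hd s hs]
    · simp only [G]
      rw [Set.indicator_of_notMem h, Set.indicator_of_notMem (fun h' => h (this.1 h')), mul_zero]
  have hcm := measurable_chart m
  have hc1 : Measurable (chart m 1) := hcm.comp (measurable_id.prodMk measurable_const)
  have hGc : ∀ s, Measurable (fun y => G (chart m s y)) := fun s =>
    hGm.comp (hcm.comp (measurable_id.prodMk measurable_const))
  have step1 : ∫⁻ x, g x ∂(Measure.pi fun _ : Fin (m+1) => expM) =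
      ∫⁻ x : Fin (m+1) → ℝ, G x * expD (∑ i, x i) := by
    rw [pi_expM, lintegral_withDensity_eq_lintegral_mul _ (by fun_prop) hg]
    refine lintegral_congr fun x => ?_
    rw [Pi.mul_apply, prod_expD]
    by_cases h : x ∈ Q
    · simp only [G]
      rw [Set.indicator_of_mem h, Set.indicator_of_mem (by exact h), one_mul, mul_comm]
    · simp only [G]
      rw [Set.indicator_of_notMem h, Set.indicator_of_notMem (by exact h)]; simp
  have step2 : ∫⁻ x : Fin (m+1) → ℝ, G x * expD (∑ i, x i) =
      ∫⁻ y : Fin m → ℝ, ∫⁻ s : ℝ, G (chart m s y) * expD s := by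
    rw [← (volume_preserving_piFinSuccAbove (fun _ : Fin (m+1) => ℝ) 0).symm.lintegral_comp
      (by fun_prop), Measure.volume_eq_prod, lintegral_prod_symm _ (by
        refine Measurable.aemeasurable ?_
        exact (show Measurable fun x : Fin (m+1) → ℝ => G x * expD (∑ i, x i) by fun_prop).comp
          (MeasurableEquiv.measurable _))]
    refine lintegral_congr fun y => ?_
    rw [← lintegral_sub_right_eq_self _ (∑ i, y i)]
    refine lintegral_congr fun s => ?_
    have : (MeasurableEquiv.piFinSuccAbove (fun _ : Fin (m+1) => ℝ) 0).symm (s - ∑ i, y i, y)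
        = chart m s y := by
      simp [MeasurableEquiv.piFinSuccAbove, chart]
      rfl
    simp only [this, chart_sum]
  have step3 : ∀ s : ℝ, 0 < s → ∫⁻ y : Fin m → ℝ, G (chart m s y) =
      ENNReal.ofReal (s ^ (m + d)) * ∫⁻ y : Fin m → ℝ, G (chart m 1 y) := by
    intro s hs
    have h := Measure.map_addHaar_smul (volume : Measure (Fin m → ℝ)) hs.ne'
    have h2 : ∫⁻ y, G (chart m s y) ∂(Measure.map (s • ·) (volume : Measure (Fin m → ℝ))) =
        ENNReal.ofReal (s ^ d) * ∫⁻ y : Fin m → ℝ, G (chart m 1 y) := by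
      rw [lintegral_map (hGc s) (by fun_prop), ← lintegral_const_mul _ (hGc 1)]
      refine lintegral_congr fun y => ?_
      rw [← hGd s hs]
      congr 1
      ext i
      refine Fin.cases ?_ (fun j => ?_) i
      · simp [chart, mul_sub, Finset.mul_sum]
      · simp [chart]
    rw [h, lintegral_smul_measure] at h2
    rw [pow_add, ENNReal.ofReal_mul (by positivity), mul_assoc, ← h2, smul_eq_mul, ← mul_assoc,
      ← ENNReal.ofReal_mul (by positivity)]
    simp only [Module.finrank_fin_fun]
    rw [abs_of_pos (by positivity), mul_inv_cancel₀ (by positivity)]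
    simp
  have step4 : ∫⁻ y : Fin m → ℝ, G (chart m 1 y) =
      ∫⁻ y in {y : Fin m → ℝ | ∀ i, 0 ≤ chart m 1 y i}, g (chart m 1 y) := by
    rw [← lintegral_indicator (show MeasurableSet {y : Fin m → ℝ | ∀ i, 0 ≤ chart m 1 y i} from hc1 hQm)]
    rfl
  rw [step1, step2, lintegral_lintegral_swap (by
    refine Measurable.aemeasurable ?_
    exact (hGm.comp hcm).mul (hm.comp measurable_snd)), ← step4, ← lint_gamma,
    ← lintegral_mul_const _ (by fun_prop)]
  refine lintegral_congr_ae ?_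
  have h0 : ∀ᵐ s : ℝ, s ≠ 0 := by simp [ae_iff]
  filter_upwards [h0] with s hs
  rw [lintegral_mul_const _ (hGc s)]
  rcases lt_or_gt_of_ne hs with h | h
  · have : expD s = 0 := Set.indicator_of_notMem (by simpa using h) _
    simp [this]
  · rw [step3 s h]; ring

/-- linear part of the chart -/
noncomputable def chartLin (m : ℕ) : (Fin m → ℝ) →ₗ[ℝ] EuclideanSpace ℝ (Fin (m+1)) where
  toFun y := WithLp.toLp 2 (chart m 0 y)
  map_add' y z := by
    ext i
    refine Fin.cases ?_ (fun j => ?_) i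
    · simp [chart, Finset.sum_add_distrib]; ring
    · simp [chart]
  map_smul' r y := by
    ext i
    refine Fin.cases ?_ (fun j => ?_) i
    · simp [chart, Finset.mul_sum]
    · simp [chart]

theorem chartLin_injective (m : ℕ) : Function.Injective (chartLin m) := by
  intro y z h
  ext i
  have := congrArg (fun v : EuclideanSpace ℝ (Fin (m+1)) => v i.succ) h
  simpa [chartLin, chart] using this

theorem hausdorff_chart (m : ℕ) : ∃ c : ℝ≥0∞, c ≠ 0 ∧ c ≠ ⊤ ∧
    Measure.map (fun y => WithLp.toLp 2 (chart m 1 y)) (volume : Measure (Fin m → ℝ)) =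
      c • (μH[(m:ℝ)] : Measure (EuclideanSpace ℝ (Fin (m+1)))).restrict
        (Set.range (fun y => WithLp.toLp 2 (chart m 1 y))) := by
  let V := LinearMap.range (chartLin m)
  let e : (Fin m → ℝ) ≃L[ℝ] V :=
    (LinearEquiv.ofInjective (chartLin m) (chartLin_injective m)).toContinuousLinearEquiv
  have hfin : Module.finrank ℝ V = m := by
    rw [← e.toLinearEquiv.finrank_eq]; simp
  let p : EuclideanSpace ℝ (Fin (m+1)) := WithLp.toLp 2 (Fin.cons 1 0)
  let f : V → EuclideanSpace ℝ (Fin (m+1)) := fun v => p + v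
  have hf : Isometry f := (isometry_add_left p).comp isometry_subtype_coe
  have hfe : (fun y => WithLp.toLp 2 (chart m 1 y)) = f ∘ e := by
    ext y i
    have : ((e y : V) : EuclideanSpace ℝ (Fin (m+1))) = WithLp.toLp 2 (chart m 0 y) := rfl
    simp only [f, Function.comp, this]
    refine Fin.cases ?_ (fun j => ?_) i
    · simp [chart, p]; ring
    · simp [chart, p]
  have hH : (μH[(m:ℝ)] : Measure V).IsAddHaarMeasure := by
    have := isAddHaarMeasure_hausdorffMeasure (E := V)
    rwa [hfin] at this
  have hM : (Measure.map e (volume : Measure (Fin m → ℝ))).IsAddHaarMeasure := inferInstance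
  have huniq := Measure.isAddLeftInvariant_eq_smul (Measure.map e (volume : Measure (Fin m → ℝ)))
    (μH[(m:ℝ)] : Measure V)
  have hpos := Measure.addHaarScalarFactor_pos_of_isAddHaarMeasure
    (Measure.map e (volume : Measure (Fin m → ℝ))) (μH[(m:ℝ)] : Measure V)
  generalize Measure.addHaarScalarFactor (Measure.map e (volume : Measure (Fin m → ℝ)))
    (μH[(m:ℝ)] : Measure V) = k at huniq hpos
  refine ⟨_, ENNReal.coe_ne_zero.2 hpos.ne', ENNReal.coe_ne_top, ?_⟩
  rw [hfe, ← Measure.map_map hf.continuous.measurable e.continuous.measurable, huniq,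
    Measure.map_smul, hf.map_hausdorffMeasure (Or.inl (by positivity)), Set.range_comp,
    e.surjective.range_eq, Set.image_univ]
  rfl

theorem portfolio_return_fourth_moment (n : ℕ) (hn : 1 ≤ n) (R : Fin n → ℝ) :
    let Δ : Set (EuclideanSpace ℝ (Fin n)) := {x | (∀ i, 0 ≤ x i) ∧ ∑ i, x i = 1}
    let μ0 : Measure (EuclideanSpace ℝ (Fin n)) := (μH[(n : ℝ) - 1]).restrict Δ
    let μ : Measure (EuclideanSpace ℝ (Fin n)) := (μ0 Set.univ)⁻¹ • μ0
    let M₁ : ℝ := (1 / n) * ∑ i, R i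
    (∫ x, (∑ i, R i * x i - M₁) ^ 4 ∂μ)
      = (1 / (n * (n + 1) * (n + 2) * (n + 3)))
          * (6 * ∑ i, (R i - M₁) ^ 4 + 3 * (∑ i, (R i - M₁) ^ 2) ^ 2) := by
  intro Δ μ0 μ M₁
  obtain ⟨m, rfl⟩ : ∃ m, n = m + 1 := ⟨n - 1, by omega⟩
  set a : Fin (m+1) → ℝ := fun i => R i - M₁ with ha
  have ha0 : ∑ i, a i = 0 := by
    have : ((m:ℝ) + 1) ≠ 0 := by positivity
    simp [a, M₁, Finset.sum_sub_distrib]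
    field_simp
    simp
  obtain ⟨c, hc0, hct, hc⟩ := hausdorff_chart m
  set φ : (Fin m → ℝ) → EuclideanSpace ℝ (Fin (m+1)) := fun y => WithLp.toLp 2 (chart m 1 y) with hφ
  have hφc : Measurable φ := (WithLp.measurable_toLp 2 _).comp
    ((measurable_chart m).comp (measurable_id.prodMk measurable_const))
  have hΔm : MeasurableSet Δ := by
    have : Δ = (⋂ i, {x | 0 ≤ x i}) ∩ {x | ∑ i, x i = 1} := by ext; simp [Δ]
    rw [this]
    refine MeasurableSet.inter (MeasurableSet.iInter fun i => measurableSet_le measurable_const (by fun_prop))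
      (measurableSet_eq_fun (by fun_prop) (by fun_prop))
  have hrange : Δ ⊆ Set.range φ := by
    rintro x ⟨-, hx⟩
    refine ⟨fun i => x i.succ, ?_⟩
    ext i
    rw [Fin.sum_univ_succ] at hx
    refine Fin.cases ?_ (fun j => ?_) i
    · simp [φ, chart]; linarith
    · simp [φ, chart]
  have hpre : φ ⁻¹' Δ = {y : Fin m → ℝ | ∀ i, 0 ≤ chart m 1 y i} := by
    ext y
    simp [Δ, φ, chart_sum]
  set T := {y : Fin m → ℝ | ∀ i, 0 ≤ chart m 1 y i} with hT
  have hμ0 : Measure.map φ (volume.restrict T) = c • μ0 := by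
    rw [← hpre, ← Measure.restrict_map hφc hΔm, hc, Measure.restrict_smul,
      Measure.restrict_restrict hΔm, Set.inter_eq_left.2 hrange]
    simp [μ0]
  have hlint : ∀ g : EuclideanSpace ℝ (Fin (m+1)) → ℝ≥0∞, Measurable g →
      c * ∫⁻ x, g x ∂μ0 = ∫⁻ y in T, g (φ y) := by
    intro g hg
    rw [← lintegral_map hg hφc, hμ0, lintegral_smul_measure, smul_eq_mul]
  have hvol : ((m.factorial : ℕ) : ℝ≥0∞) * (c * μ0 Set.univ) = 1 := by
    have h := lint_cone m 0 (fun _ => 1) measurable_const (by simp)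
    have h' := hlint (fun _ => 1) measurable_const
    rw [← hT, ← h'] at h
    simpa using h.symm
  set A : ℝ := 6 * ∑ i, a i ^ 4 + 3 * (∑ i, a i ^ 2) ^ 2 with hA
  have hA0 : 0 ≤ A := by
    have : 0 ≤ ∑ i, a i ^ 4 := Finset.sum_nonneg fun i _ => by positivity
    positivity
  have hmom : (((m + 4).factorial : ℕ) : ℝ≥0∞) *
      (c * ∫⁻ x, ENNReal.ofReal ((∑ i, a i * x i) ^ 4) ∂μ0) = ENNReal.ofReal A := by
    rw [← pi_fourth a ha0, hlint _ (by fun_prop),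
      lint_cone m 4 (fun x => ENNReal.ofReal ((∑ i, a i * x i) ^ 4)) (by fun_prop)]
    intro s hs x
    rw [← ENNReal.ofReal_mul (by positivity), ← mul_pow, Finset.mul_sum]
    have e : ∑ i, a i * (s • x) i = ∑ i, s * (a i * x i) :=
      Finset.sum_congr rfl fun i _ => by simp; ring
    rw [e]
  have hΔae : ∀ᵐ x ∂μ, (∑ i, R i * x i - M₁) ^ 4 = (∑ i, a i * x i) ^ 4 := by
    refine Measure.ae_smul_measure ?_ _
    filter_upwards [ae_restrict_mem hΔm] with x hx
    simp [a, sub_mul, Finset.sum_sub_distrib, ← Finset.mul_sum, hx.2]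
  rw [integral_congr_ae hΔae, integral_eq_lintegral_of_nonneg_ae
    (Filter.Eventually.of_forall fun x => by positivity) (by fun_prop), lintegral_smul_measure,
    smul_eq_mul, ENNReal.toReal_mul, ENNReal.toReal_inv]
  have r1 := congrArg ENNReal.toReal hvol
  have r2 := congrArg ENNReal.toReal hmom
  simp only [ENNReal.toReal_mul, ENNReal.toReal_natCast, ENNReal.toReal_one,
    ENNReal.toReal_ofReal hA0] at r1 r2
  set u := (μ0 Set.univ).toReal
  set I := (∫⁻ x, ENNReal.ofReal ((∑ i, a i * x i) ^ 4) ∂μ0).toReal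
  have hf : (((m+4).factorial : ℕ) : ℝ) = (m+4) * (m+3) * (m+2) * (m+1) * (m.factorial : ℝ) := by
    simp only [Nat.factorial_succ]; push_cast; ring
  have hu : u ≠ 0 := by
    intro h; rw [h] at r1; simp at r1
  rw [hf] at r2
  have : A * u = (m+4) * (m+3) * (m+2) * (m+1) * I := by
    rw [← r2]
    linear_combination ((m+4) * (m+3) * (m+2) * (m+1) * I) * r1
  push_cast
  have h1 : (m:ℝ) + 1 ≠ 0 := by positivity
  have h2 : (m:ℝ) + 1 + 1 ≠ 0 := by positivity
  have h3 : (m:ℝ) + 1 + 2 ≠ 0 := by positivity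
  have h4 : (m:ℝ) + 1 + 3 ≠ 0 := by positivity
  rw [one_div, ← div_eq_inv_mul, ← div_eq_inv_mul, div_eq_div_iff hu (by positivity), this]
  ring
end

section
/- Let v_1,...,v_n be the vertices of an (n−1)-simplex Δ ⊂ ℝ^{n-1} and let H : (ℝ^{n-1})^q → ℝ be a symmetric q-linear form. Then ∫_Δ H(x,...,x) dx = (Vol(Δ)/C(n−1+q, q))·∑_{1 ≤ i_1 ≤ i_2 ≤ ... ≤ i_q ≤ n} H(v_{i_1},...,v_{i_q}). -/
open MeasureTheory
open scoped Nat

lemma la_beta (a b : ℕ) (s : ℝ) :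
    ∫ t in (0:ℝ)..s, t ^ a * (s - t) ^ b = s ^ (a + b + 1) * (a ! * b ! / (a + b + 1)!) := by
  induction a generalizing b with
  | zero =>
    have := intervalIntegral.integral_comp_sub_left (a := 0) (b := s) (fun x : ℝ => x ^ b) s
    simp only [pow_zero, one_mul, this, sub_self, sub_zero, integral_pow, zero_add]
    have h1 : (b ! : ℝ) ≠ 0 := by positivity
    have h2 : (b + 1 : ℝ) ≠ 0 := by positivity
    rw [Nat.factorial_succ]
    push_cast
    field_simp
    simp
  | succ a ih =>
    have key : ∫ t in (0:ℝ)..s, ((a + 1 : ℝ) / (b + 1) * (t ^ a * (s - t) ^ (b + 1))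
        - t ^ (a + 1) * (s - t) ^ b) = 0 := by
      rw [intervalIntegral.integral_eq_sub_of_hasDerivAt
        (f := fun t : ℝ => t ^ (a + 1) * (s - t) ^ (b + 1) / (b + 1))]
      · simp
      · intro x _
        have h1 := hasDerivAt_pow (a + 1) x
        have h2 := ((hasDerivAt_id' x).const_sub s).fun_pow (b + 1)
        have h3 := (h1.fun_mul h2).div_const ((b : ℝ) + 1)
        refine h3.congr_deriv ?_
        have h2 : (b + 1 : ℝ) ≠ 0 := by positivity
        push_cast
        field_simp
        ring
      · apply Continuous.intervalIntegrable
        fun_prop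
    rw [intervalIntegral.integral_sub (Continuous.intervalIntegrable (by fun_prop) _ _)
      (Continuous.intervalIntegrable (by fun_prop) _ _), intervalIntegral.integral_const_mul,
      ih, sub_eq_zero] at key
    rw [← key]
    have h2 : (b + 1 : ℝ) ≠ 0 := by positivity
    rw [Nat.factorial_succ a, Nat.factorial_succ b, show a + 1 + b + 1 = a + (b + 1) + 1 by ring]
    push_cast
    field_simp

def laS (d : ℕ) (s : ℝ) : Set (Fin d → ℝ) := {t | (∀ i, 0 ≤ t i) ∧ ∑ i, t i ≤ s}

lemma laS_closed (d : ℕ) (s : ℝ) : IsClosed (laS d s) := by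
  have : laS d s = (⋂ i, {t : Fin d → ℝ | 0 ≤ t i}) ∩ {t : Fin d → ℝ | ∑ i, t i ≤ s} := by
    ext t; simp [laS]
  rw [this]
  refine IsClosed.inter (isClosed_iInter fun i => isClosed_le continuous_const
    (continuous_apply i)) (isClosed_le (by fun_prop) continuous_const)

lemma laS_compact (d : ℕ) (s : ℝ) : IsCompact (laS d s) := by
  refine (isCompact_Icc (a := (0 : Fin d → ℝ)) (b := fun _ => s)).of_isClosed_subset
    (laS_closed d s) ?_
  rintro t ⟨h0, h1⟩
  exact ⟨h0, fun i => (Finset.single_le_sum (fun j _ => h0 j) (Finset.mem_univ i)).trans h1⟩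

lemma la_fubini (d : ℕ) (s : ℝ) (f : (Fin (d + 1) → ℝ) → ℝ) (hf : Continuous f) :
    ∫ t in laS (d + 1) s, f t =
      ∫ x in Set.Icc 0 s, ∫ y in laS d (s - x), f (Fin.cons x y) := by
  have hi : Integrable ((laS (d + 1) s).indicator f) :=
    (integrable_indicator_iff (laS_closed _ _).measurableSet).2
      (hf.continuousOn.integrableOn_compact (laS_compact _ _))
  have mp := (volume_preserving_piFinSuccAbove (fun _ : Fin (d + 1) => ℝ) 0).symm
  rw [← integral_indicator (laS_closed _ _).measurableSet, ← mp.integral_comp',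
    ← integral_indicator measurableSet_Icc]
  have hi2 := (mp.integrable_comp_emb (MeasurableEquiv.measurableEmbedding _)).2 hi
  rw [Measure.volume_eq_prod]
  rw [integral_prod]
  swap
  · exact hi2
  congr 1
  ext x
  by_cases hx : x ∈ Set.Icc 0 s
  · rw [Set.indicator_of_mem hx, ← integral_indicator (laS_closed _ _).measurableSet]
    congr 1
    ext y
    have he : (MeasurableEquiv.piFinSuccAbove (fun _ : Fin (d + 1) => ℝ) 0).symm (x, y)
        = Fin.cons x y := Fin.insertNth_zero' x y
    rw [he]
    simp only [Set.indicator, laS, Set.mem_ofPred_eq, Fin.forall_fin_succ, Fin.cons_zero,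
      Fin.cons_succ, Fin.sum_univ_succ, hx.1, true_and, le_sub_iff_add_le']
  · rw [Set.indicator_of_notMem hx]
    apply integral_eq_zero_of_ae
    refine Filter.Eventually.of_forall fun y => ?_
    have he : (MeasurableEquiv.piFinSuccAbove (fun _ : Fin (d + 1) => ℝ) 0).symm (x, y)
        = Fin.cons x y := Fin.insertNth_zero' x y
    simp only [he, Pi.zero_apply]
    apply Set.indicator_of_notMem
    rintro ⟨h0, h1⟩
    apply hx
    have h3 : 0 ≤ ∑ i, y i := Finset.sum_nonneg fun i _ => by simpa using h0 i.succ
    have h4 := h0 0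
    simp only [Fin.sum_univ_succ, Fin.cons_zero, Fin.cons_succ] at h1 h4
    exact ⟨h4, by linarith⟩

lemma la_dirichlet (d : ℕ) (a : Fin d → ℕ) (b : ℕ) (s : ℝ) (hs : 0 ≤ s) :
    ∫ t in laS d s, (s - ∑ i, t i) ^ b * ∏ i, t i ^ a i =
      s ^ (d + (b + ∑ i, a i)) * ((b ! * ∏ i, (a i)! : ℝ) / (d + (b + ∑ i, a i))!) := by
  induction d generalizing s with
  | zero =>
    have : laS 0 s = Set.univ := by ext; simp [laS, hs]
    rw [this]
    have h1 : (b ! : ℝ) ≠ 0 := by positivity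
    simp [integral_unique, h1, Measure.real, volume_pi]
  | succ d ih =>
    rw [la_fubini _ _ _ (by fun_prop)]
    have : ∀ x ∈ Set.Icc 0 s, ∫ y in laS d (s - x), (s - ∑ i, (Fin.cons x y : Fin (d+1) → ℝ) i) ^ b
        * ∏ i, (Fin.cons x y : Fin (d+1) → ℝ) i ^ a i
        = (x ^ a 0 * (s - x) ^ (d + (b + ∑ i, a (Fin.succ i))))
          * ((b ! * ∏ i, (a (Fin.succ i))! : ℝ) / (d + (b + ∑ i, a (Fin.succ i)))!) := by
      intro x hx
      rw [mul_assoc, ← ih (fun i => a i.succ) (s - x) (by linarith [hx.2]), ← integral_const_mul]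
      congr 1
      ext y
      simp only [Fin.sum_univ_succ, Fin.prod_univ_succ, Fin.cons_zero, Fin.cons_succ]
      ring
    rw [setIntegral_congr_fun measurableSet_Icc this, integral_mul_const,
      integral_Icc_eq_integral_Ioc, ← intervalIntegral.integral_of_le hs, la_beta]
    simp only [Fin.sum_univ_succ, Fin.prod_univ_succ]
    rw [show a 0 + (d + (b + ∑ i, a (Fin.succ i))) + 1
      = d + 1 + (b + (a 0 + ∑ i, a (Fin.succ i))) by ring]
    push_cast
    field_simp

lemma la_comb (n q : ℕ) (f : (Fin q → Fin n) → ℝ)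
    (hf : ∀ (σ : Equiv.Perm (Fin q)) m, f (m ∘ σ) = f m) :
    ∑ m, (∏ i, (Fintype.card {j // m j = i})! : ℝ) * f m
      = q ! * ∑ m ∈ Finset.univ.filter (fun m : Fin q → Fin n =>
              ∀ j k : Fin q, j ≤ k → m j ≤ m k), f m := by
  classical
  have h1 : ∀ m : Fin q → Fin n, (∏ i, (Fintype.card {j // m j = i})!)
      = Fintype.card {σ : Equiv.Perm (Fin q) // Monotone (m ∘ σ)} := by
    intro m
    rw [← DomMulAct.stabilizer_card]
    refine Fintype.card_congr ((Equiv.mulRight (Tuple.sort m)).subtypeEquiv fun g => ?_)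
    rw [← Tuple.comp_sort_eq_comp_iff_monotone]
    simp only [Equiv.coe_mulRight, Equiv.Perm.coe_mul, ← Function.comp_assoc]
    rw [Function.Surjective.right_cancellable (Tuple.sort m).surjective]
  have h2 : ∀ m : Fin q → Fin n, (∏ i, (Fintype.card {j // m j = i})! : ℝ) * f m
      = ∑ σ : Equiv.Perm (Fin q), if Monotone (m ∘ σ) then f (m ∘ σ) else 0 := by
    intro m
    rw [← Nat.cast_prod, h1, Fintype.card_subtype]
    simp only [hf]
    rw [← Finset.sum_filter, Finset.sum_const, nsmul_eq_mul]
  rw [Finset.sum_congr rfl fun m _ => h2 m, Finset.sum_comm]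
  have h3 : ∀ σ : Equiv.Perm (Fin q), ∑ m : Fin q → Fin n,
      (if Monotone (m ∘ σ) then f (m ∘ σ) else 0) = ∑ m ∈ Finset.univ.filter
        (fun m : Fin q → Fin n => ∀ j k : Fin q, j ≤ k → m j ≤ m k), f m := by
    intro σ
    rw [Finset.sum_filter]
    rw [← (Equiv.arrowCongr σ (Equiv.refl (Fin n))).sum_comp]
    refine Finset.sum_congr rfl fun m _ => ?_
    have : (Equiv.arrowCongr σ (Equiv.refl (Fin n))) m ∘ σ = m := by
      ext; simp [Equiv.arrowCongr]
    rw [this]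
    rfl
  rw [Finset.sum_congr rfl fun m _ => h3 m]
  simp [Fintype.card_perm]

/-- barycentric coordinates -/
def laW (d : ℕ) (t : Fin d → ℝ) : Fin (d + 1) → ℝ := Fin.cons (1 - ∑ i, t i) t

lemma la_hull (d : ℕ) {E : Type*} [AddCommGroup E] [Module ℝ E] (v : Fin (d + 1) → E) :
    convexHull ℝ (Set.range v) = (fun t => ∑ i, laW d t i • v i) '' laS d 1 := by
  apply Set.Subset.antisymm
  · apply convexHull_min
    · rintro _ ⟨i, rfl⟩
      refine ⟨fun j => if j.succ = i then 1 else 0, ⟨fun j => ?_, ?_⟩, ?_⟩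
      · dsimp only; split_ifs <;> simp
      · refine Fin.cases ?_ (fun k => ?_) i <;> simp
      · refine Fin.cases ?_ (fun k => ?_) i <;> simp [laW, Fin.sum_univ_succ]
    · rintro _ ⟨t, ht, rfl⟩ _ ⟨u, hu, rfl⟩ a b ha hb hab
      refine ⟨a • t + b • u, ⟨fun j => ?_, ?_⟩, ?_⟩
      · exact add_nonneg (mul_nonneg ha (ht.1 j)) (mul_nonneg hb (hu.1 j))
      · simp only [Pi.add_apply, Pi.smul_apply, smul_eq_mul, Finset.sum_add_distrib,
          ← Finset.mul_sum]
        calc _ ≤ a * 1 + b * 1 := add_le_add (mul_le_mul_of_nonneg_left ht.2 ha)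
              (mul_le_mul_of_nonneg_left hu.2 hb)
          _ = 1 := by linarith
      · simp only [Finset.smul_sum, ← Finset.sum_add_distrib, smul_smul, ← add_smul]
        refine Finset.sum_congr rfl fun i _ => ?_
        congr 1
        refine Fin.cases ?_ (fun k => ?_) i
        · simp only [laW, Fin.cons_zero, Pi.add_apply, Pi.smul_apply, smul_eq_mul,
            Finset.sum_add_distrib, ← Finset.mul_sum]
          linear_combination -hab
        · simp [laW]
  · rintro _ ⟨t, ht, rfl⟩
    refine (convex_convexHull ℝ _).sum_mem (fun i _ => ?_) ?_
      (fun i _ => subset_convexHull ℝ _ ⟨i, rfl⟩)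
    · refine Fin.cases ?_ (fun k => ?_) i
      · simpa [laW] using ht.2
      · simpa [laW] using ht.1 k
    · simp [laW, Fin.sum_univ_succ]

lemma la_mono (d q : ℕ) (m : Fin q → Fin (d + 1)) :
    ∫ t in laS d 1, ∏ j, laW d t (m j) =
      (∏ i, (Fintype.card {j // m j = i})! : ℝ) / (d + q)! := by
  have h := la_dirichlet d (fun i => Fintype.card {j // m j = i.succ})
    (Fintype.card {j // m j = 0}) 1 zero_le_one
  have hq : Fintype.card {j // m j = 0} + ∑ i : Fin d, Fintype.card {j // m j = i.succ} = q := by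
    rw [← Fin.sum_univ_succ (fun i => Fintype.card {j // m j = i})]
    simp only [Fintype.card_subtype]
    rw [← Finset.card_eq_sum_card_fiberwise (fun _ _ => Finset.mem_coe.2 (Finset.mem_univ _))]
    simp
  rw [hq, one_pow, one_mul] at h
  rw [Fin.prod_univ_succ]
  push_cast at h ⊢
  rw [← h]
  congr 1
  ext t
  rw [← Finset.prod_fiberwise' Finset.univ m (laW d t), Fin.prod_univ_succ]
  simp [laW, Fintype.card_subtype]

lemma la_cov (d : ℕ) (v : Fin (d + 1) → EuclideanSpace ℝ (Fin d)) (hv : AffineIndependent ℝ v) :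
    ∃ c : ℝ, ∀ f : EuclideanSpace ℝ (Fin d) → ℝ, 
      ∫ x in convexHull ℝ (Set.range v), f x
        = c * ∫ t in laS d 1, f (∑ i, laW d t i • v i) := by
  have hl : LinearIndependent ℝ (fun i : Fin d => v i.succ - v 0) := by
    have := (affineIndependent_iff_linearIndependent_vsub ℝ v 0).1 hv
    exact this.comp (fun i : Fin d => (⟨i.succ, Fin.succ_ne_zero i⟩ : {x // x ≠ (0 : Fin (d + 1))}))
      (fun i j h => by simpa using h)
  let B : Module.Basis (Fin d) ℝ (EuclideanSpace ℝ (Fin d)) :=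
    basisOfLinearIndependentOfCardEqFinrank' (fun i : Fin d => v i.succ - v 0) hl (by simp)
  let L : (Fin d → ℝ) ≃L[ℝ] EuclideanSpace ℝ (Fin d) := B.equivFun.symm.toContinuousLinearEquiv
  have hL : ∀ t, L t = ∑ i, t i • (v i.succ - v 0) := by
    intro t
    change B.equivFun.symm t = _
    rw [Module.Basis.equivFun_symm_apply]
    simp [B]
  let ph : (Fin d → ℝ) ≃ₜ EuclideanSpace ℝ (Fin d) := L.toHomeomorph.trans (Homeomorph.addRight (v 0))
  have hph : ∀ t, ph t = ∑ i, laW d t i • v i := by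
    intro t
    change L t + v 0 = _
    rw [hL, Fin.sum_univ_succ]
    simp [laW, smul_sub, sub_smul, Finset.sum_smul]
    abel
  have : (Measure.map L (volume : Measure (Fin d → ℝ))).IsAddHaarMeasure :=
    L.isAddHaarMeasure_map volume
  set c := Measure.addHaarScalarFactor (volume : Measure (EuclideanSpace ℝ (Fin d)))
    (Measure.map L (volume : Measure (Fin d → ℝ)))
  have hc : (volume : Measure (EuclideanSpace ℝ (Fin d))) = c • Measure.map ph volume := by
    have h1 : (volume : Measure (EuclideanSpace ℝ (Fin d))) = c • Measure.map L volume :=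
      Measure.isAddLeftInvariant_eq_smul _ _
    have h2 : Measure.map ph volume = Measure.map (· + v 0) (Measure.map L volume) := by
      rw [Measure.map_map (by fun_prop) L.continuous.measurable]
      rfl
    rw [h2, map_add_right_eq_self]
    exact h1
  refine ⟨c, fun f => ?_⟩
  have himg : convexHull ℝ (Set.range v) = ph '' laS d 1 := by
    rw [la_hull]
    exact Set.image_congr fun t _ => (hph t).symm
  rw [hc, Measure.restrict_smul, integral_smul_nnreal_measure, himg,
    ph.measurableEmbedding.setIntegral_map, ph.injective.preimage_image]
  simp only [hph]
  rfl

theorem la_main (d q : ℕ) 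
    (v : Fin (d + 1) → EuclideanSpace ℝ (Fin d)) (hv : AffineIndependent ℝ v)
    (H : MultilinearMap ℝ (fun _ : Fin q => EuclideanSpace ℝ (Fin d)) ℝ)
    (hH : ∀ (σ : Equiv.Perm (Fin q)) (x : Fin q → EuclideanSpace ℝ (Fin d)),
      H (x ∘ σ) = H x) :
    (∫ x in convexHull ℝ (Set.range v), H (fun _ => x))
      = ((volume (convexHull ℝ (Set.range v))).toReal / (d + q).choose q)
          * ∑ m ∈ Finset.univ.filter (fun m : Fin q → Fin (d + 1) =>
              ∀ j k : Fin q, j ≤ k → m j ≤ m k),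
            H (fun j => v (m j)) := by
  obtain ⟨c, hc⟩ := la_cov d v hv
  have hvol : (volume (convexHull ℝ (Set.range v))).toReal = c * (1 / d !) := by
    have h1 := hc (fun _ => 1)
    have h2 := la_dirichlet d 0 0 1 zero_le_one
    simp only [setIntegral_const, smul_eq_mul, mul_one] at h1
    simp only [pow_zero, Pi.zero_apply, Finset.prod_const_one, mul_one, setIntegral_const,
      smul_eq_mul, one_pow, one_mul, Finset.sum_const_zero, add_zero, Nat.factorial_zero,
      Nat.cast_one] at h2
    rw [h2] at h1
    exact h1
  have hexp : ∀ t : Fin d → ℝ, H (fun _ => ∑ i, laW d t i • v i)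
      = ∑ m : Fin q → Fin (d + 1), (∏ j, laW d t (m j)) * H (fun j => v (m j)) := by
    intro t
    rw [MultilinearMap.map_sum]
    refine Finset.sum_congr rfl fun m _ => ?_
    rw [MultilinearMap.map_smul_univ, smul_eq_mul]
  have hcont : ∀ i, Continuous fun t => laW d t i := by
    intro i
    refine Fin.cases ?_ (fun k => ?_) i
    · simp only [laW, Fin.cons_zero]; fun_prop
    · simp only [laW, Fin.cons_succ]; fun_prop
  have hcomb := la_comb (d + 1) q (fun m => H (fun j => v (m j)))
    (fun σ m => hH σ (fun j => v (m j)))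
  rw [hc, hvol]
  simp only [hexp]
  rw [integral_finsetSum _ fun m _ => ?_]
  swap
  · refine ContinuousOn.integrableOn_compact (laS_compact _ _) (Continuous.continuousOn ?_)
    exact (continuous_finsetProd _ fun j _ => hcont (m j)).mul continuous_const
  simp only [integral_mul_const, la_mono, div_mul_eq_mul_div]
  rw [← Finset.sum_div, hcomb, Nat.add_choose]
  rw [Nat.cast_div (Nat.factorial_mul_factorial_dvd_factorial_add d q) (by positivity)]
  push_cast
  field_simp

theorem lasserre_avrachenkov (n q : ℕ) (hn : 1 ≤ n)
    (v : Fin n → EuclideanSpace ℝ (Fin (n - 1))) (hv : AffineIndependent ℝ v)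
    (H : MultilinearMap ℝ (fun _ : Fin q => EuclideanSpace ℝ (Fin (n - 1))) ℝ)
    (hH : ∀ (σ : Equiv.Perm (Fin q)) (x : Fin q → EuclideanSpace ℝ (Fin (n - 1))),
      H (x ∘ σ) = H x) :
    (∫ x in convexHull ℝ (Set.range v), H (fun _ => x))
      = ((volume (convexHull ℝ (Set.range v))).toReal / (n - 1 + q).choose q)
          * ∑ m ∈ Finset.univ.filter (fun m : Fin q → Fin n =>
              ∀ j k : Fin q, j ≤ k → m j ≤ m k),
            H (fun j => v (m j)) := by
  obtain ⟨d, rfl⟩ : ∃ d, n = d + 1 := ⟨n - 1, by omega⟩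
  exact la_main d q v hv H hH
end

section
/- Let R ∈ ℝ^n with all R_i distinct and let F(R*) denote the normalized volume of {x ∈ Δ^{n-1} : ∑ R_i x_i ≤ R*}. Then F(R*) = ∑_{i : R_i ≤ R*} (R* − R_i)^{n-1} / ∏_{j ≠ i} (R_j − R_i) for all R* ∈ ℝ. -/
open MeasureTheory

/-- Truncated power. -/
noncomputable def tpow (k : ℕ) (a : ℝ) : ℝ := if 0 ≤ a then a ^ k else 0

theorem tpow_nonneg (k : ℕ) (a : ℝ) : 0 ≤ tpow k a := by
  unfold tpow; split_ifs <;> positivity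

theorem tpow_mono (k : ℕ) : Monotone (tpow k) := by
  intro a b h
  unfold tpow
  split_ifs with h1 h2 h2
  · gcongr
  · linarith
  · positivity
  · exact le_rfl

theorem tpow_succ_eq (k : ℕ) (a : ℝ) : tpow (k + 1) a = (max a 0) ^ (k + 1) := by
  unfold tpow
  split_ifs with h
  · rw [max_eq_left h]
  · rw [max_eq_right (by linarith)]; simp

theorem tpow_integral (k : ℕ) (a b : ℝ) :
    ∫ x in a..b, tpow k x = (tpow (k + 1) b - tpow (k + 1) a) / (k + 1) := by
  have hk : (k + 1 : ℝ) ≠ 0 := by positivity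
  have := integral_eq_of_hasDerivAt_off_countable (fun x => tpow (k + 1) x / (k + 1)) (tpow k)
    (a := a) (b := b) (s := {0}) (Set.countable_singleton _) (by
      simp only [tpow_succ_eq]
      fun_prop) (by
      intro x hx
      have hx0 : x ≠ 0 := hx.2
      rcases lt_or_gt_of_ne hx0 with h | h
      · have : tpow k x = 0 := by simp [tpow, h]
        rw [this]
        refine (hasDerivAt_const x (0 : ℝ)).congr_of_eventuallyEq ?_
        filter_upwards [eventually_lt_nhds h] with y hy
        simp [tpow, hy]
      · have : tpow k x = ((k + 1 : ℕ) : ℝ) * x ^ k / (k + 1) := by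
          rw [tpow, if_pos h.le]; push_cast; field_simp
        rw [this]
        refine ((hasDerivAt_pow (k + 1) x).div_const (k + 1 : ℝ)).congr_of_eventuallyEq ?_
        filter_upwards [eventually_gt_nhds h] with y hy
        simp [tpow, hy.le])
    (tpow_mono k).intervalIntegrable
  rw [this]; ring

theorem tpow_comp_intervalIntegrable (k : ℕ) (a b s : ℝ) :
    IntervalIntegrable (fun u => tpow k (a - b * u)) volume 0 s := by
  rcases le_total 0 b with h | h
  · apply Antitone.intervalIntegrable
    intro x y hxy
    apply tpow_mono
    nlinarith
  · apply Monotone.intervalIntegrable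
    intro x y hxy
    apply tpow_mono
    nlinarith

theorem tpow_comp_integral (k : ℕ) (a b s : ℝ) (hb : b ≠ 0) :
    ∫ u in (0 : ℝ)..s, tpow k (a - b * u)
      = (tpow (k + 1) a - tpow (k + 1) (a - b * s)) / (k + 1) * b⁻¹ := by
  rw [intervalIntegral.integral_comp_sub_mul _ hb, tpow_integral]
  simp; ring

/-- The explicit weighted sum. -/
noncomputable def wsum (m : ℕ) (R : Fin (m + 1) → ℝ) (s t : ℝ) : ℝ :=
  ((m.factorial : ℝ))⁻¹ * ∑ i, tpow m (t - s * R i) * ∏ j ∈ Finset.univ.erase i, (R j - R i)⁻¹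

theorem prod_sign (m : ℕ) (R : Fin (m + 1) → ℝ) (i : Fin (m + 1)) :
    ∏ j ∈ Finset.univ.erase i, (R j - R i)⁻¹
      = (-1) ^ m * (∏ j ∈ Finset.univ.erase i, (R i - R j))⁻¹ := by
  have : ∏ j ∈ Finset.univ.erase i, (R j - R i)⁻¹
      = ∏ j ∈ Finset.univ.erase i, ((-1) * (R i - R j)⁻¹) := by
    refine Finset.prod_congr rfl fun j _ => ?_
    rw [← neg_sub, inv_neg]; ring
  rw [this, Finset.prod_mul_distrib, Finset.prod_const, Finset.prod_inv_distrib]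
  simp

theorem sum_weights_zero (m : ℕ) (R : Fin (m + 2) → ℝ) (hR : Function.Injective R) :
    ∑ i, ∏ j ∈ Finset.univ.erase i, (R j - R i)⁻¹ = 0 := by
  have h := Lagrange.coeff_eq_sum (s := Finset.univ) (v := R) hR.injOn
    (P := (1 : Polynomial ℝ)) (by
      rw [Polynomial.degree_one, Finset.card_univ, Fintype.card_fin]
      exact_mod_cast Nat.succ_pos _)
  simp only [prod_sign, ← Finset.mul_sum]
  simp only [Finset.card_univ, Fintype.card_fin, Polynomial.eval_one, one_div,
    Polynomial.coeff_one] at h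
  rw [← h]; simp

theorem sum_weights_pow (m : ℕ) (R : Fin (m + 1) → ℝ) (hR : Function.Injective R) (t : ℝ) :
    ∑ i, (t - R i) ^ m * ∏ j ∈ Finset.univ.erase i, (R j - R i)⁻¹ = 1 := by
  have hd : ((Polynomial.X - Polynomial.C t) ^ m : Polynomial ℝ).degree = m := by
    simp
  have h := Lagrange.leadingCoeff_eq_sum (s := Finset.univ) (v := R) hR.injOn
    (P := ((Polynomial.X - Polynomial.C t) ^ m : Polynomial ℝ)) (by
      rw [hd, Finset.card_univ, Fintype.card_fin]
      push_cast; rfl)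
  rw [((Polynomial.monic_X_sub_C t).pow m).leadingCoeff] at h
  rw [h]
  refine Finset.sum_congr rfl fun i _ => ?_
  rw [prod_sign]
  simp only [Polynomial.eval_pow, Polynomial.eval_sub, Polynomial.eval_X, Polynomial.eval_C]
  rw [← neg_sub (R i) t, neg_pow, div_eq_mul_inv]
  have : ((-1 : ℝ) ^ m) * (-1) ^ m = 1 := by rw [← mul_pow]; simp
  linear_combination ((R i - t) ^ m * (∏ j ∈ Finset.univ.erase i, (R i - R j))⁻¹) * this

theorem prod_erase_succ (m : ℕ) (R : Fin (m + 2) → ℝ) (i : Fin (m + 1)) :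
    ∏ j ∈ Finset.univ.erase i.succ, (R j - R i.succ)⁻¹
      = (R 0 - R i.succ)⁻¹ * ∏ j ∈ Finset.univ.erase i, (R j.succ - R i.succ)⁻¹ := by
  have : Finset.univ.erase i.succ
      = insert 0 ((Finset.univ.erase i).map (Fin.succEmb _)) := by
    ext j
    refine Fin.cases ?_ (fun j => ?_) j
    · simp [(Fin.succ_ne_zero i).symm]
    · simp [Fin.succ_ne_zero]
  rw [this, Finset.prod_insert (by simp [Fin.succ_ne_zero]), Finset.prod_map]
  simp

theorem wsum_integrand_intervalIntegrable (m : ℕ) (R : Fin (m + 2) → ℝ) (s t : ℝ) :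
    IntervalIntegrable (fun u => wsum m (fun i => R i.succ) (s - u) (t - R 0 * u)) volume 0 s := by
  unfold wsum
  apply IntervalIntegrable.const_mul
  rw [← Finset.sum_fn]
  apply IntervalIntegrable.sum
  intro i _
  apply IntervalIntegrable.mul_const
  convert tpow_comp_intervalIntegrable m (t - s * R i.succ) (R 0 - R i.succ) s using 3
  ring

theorem wsum_succ (m : ℕ) (R : Fin (m + 2) → ℝ) (hR : Function.Injective R) (s t : ℝ) :
    ∫ u in (0 : ℝ)..s, wsum m (fun i => R i.succ) (s - u) (t - R 0 * u)
      = wsum (m + 1) R s t := by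
  have key : ∀ i : Fin (m + 1), ∀ u : ℝ, t - R 0 * u - (s - u) * R i.succ
      = (t - s * R i.succ) - (R 0 - R i.succ) * u := by intros; ring
  have hz := sum_weights_zero m R hR
  rw [Fin.sum_univ_succ] at hz
  unfold wsum
  simp only [key]
  rw [intervalIntegral.integral_const_mul, intervalIntegral.integral_finsetSum]
  · simp only [intervalIntegral.integral_mul_const]
    rw [Fin.sum_univ_succ (n := m + 1), eq_neg_of_add_eq_zero_left hz, mul_neg, Finset.mul_sum, Finset.mul_sum,
      ← Finset.sum_neg_distrib, ← Finset.sum_add_distrib, Finset.mul_sum]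
    refine Finset.sum_congr rfl fun i _ => ?_
    have hne : R 0 - R i.succ ≠ 0 :=
      sub_ne_zero.2 fun h => (Fin.succ_ne_zero i).symm (hR h)
    rw [tpow_comp_integral _ _ _ _ hne, prod_erase_succ, Nat.factorial_succ]
    have e : t - s * R i.succ - (R 0 - R i.succ) * s = t - s * R 0 := by ring
    rw [e]
    push_cast
    rw [mul_inv]
    ring
  · intro i _
    exact (tpow_comp_intervalIntegrable m _ _ s).mul_const _

/-- The solid corner simplex cut by a half space. -/
def cutSet (m : ℕ) (R : Fin (m + 1) → ℝ) (s t : ℝ) : Set (Fin m → ℝ) :=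
  {y | (∀ i, 0 ≤ y i) ∧ ∑ i, y i ≤ s ∧
    ∑ i, R i.castSucc * y i + R (Fin.last m) * (s - ∑ i, y i) ≤ t}

theorem cutSet_measurable (m : ℕ) (R : Fin (m + 1) → ℝ) (s t : ℝ) :
    MeasurableSet (cutSet m R s t) := by
  apply IsClosed.measurableSet
  have : cutSet m R s t = (⋂ i, {y | 0 ≤ y i}) ∩ ({y | ∑ i, y i ≤ s} ∩
    {y | ∑ i, R i.castSucc * y i + R (Fin.last m) * (s - ∑ i, y i) ≤ t}) := by
    ext y; simp [cutSet]
  rw [this]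
  refine (isClosed_iInter fun i => isClosed_le (by fun_prop) (by fun_prop)).inter
    ((isClosed_le (by fun_prop) (by fun_prop)).inter (isClosed_le (by fun_prop) (by fun_prop)))

theorem cutSet_cons (m : ℕ) (R : Fin (m + 2) → ℝ) (s t u : ℝ) (y : Fin m → ℝ) :
    (Fin.cons u y : Fin (m + 1) → ℝ) ∈ cutSet (m + 1) R s t ↔
      0 ≤ u ∧ y ∈ cutSet m (fun i => R i.succ) (s - u) (t - R 0 * u) := by
  simp only [cutSet, Set.mem_ofPred_eq, Fin.forall_fin_succ, Fin.cons_zero, Fin.cons_succ,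
    Fin.sum_univ_succ, Fin.castSucc_zero, Fin.succ_last, Fin.succ_castSucc, and_assoc]
  have e1 : u + ∑ i, y i ≤ s ↔ ∑ i, y i ≤ s - u := by
    constructor <;> intro h <;> linarith
  rw [e1]
  refine and_congr_right fun _ => and_congr_right fun _ => and_congr_right fun _ => ?_
  have : R (Fin.last (m + 1)) * (s - (u + ∑ i, y i))
    = R (Fin.last (m + 1)) * (s - u - ∑ i, y i) := by ring
  rw [this]
  constructor <;> intro h <;> linarith

theorem cutSet_empty (m : ℕ) (R : Fin (m + 1) → ℝ) (s t : ℝ) (hs : s < 0) :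
    cutSet m R s t = ∅ := by
  ext y
  simp only [cutSet, Set.mem_ofPred_eq, Set.mem_empty_iff_false, iff_false]
  rintro ⟨h1, h2, -⟩
  have := Finset.sum_nonneg fun i (_ : i ∈ Finset.univ) => h1 i
  linarith

theorem volume_cutSet (m : ℕ) : ∀ (R : Fin (m + 1) → ℝ), Function.Injective R →
    ∀ s t : ℝ, 0 ≤ s →
      volume (cutSet m R s t) = ENNReal.ofReal (wsum m R s t) ∧ 0 ≤ wsum m R s t := by
  induction m with
  | zero =>
    intro R _ s t hs
    have hw : wsum 0 R s t = tpow 0 (t - s * R 0) := by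
      simp [wsum, Finset.univ_unique]
    rw [hw]
    refine ⟨?_, tpow_nonneg _ _⟩
    rw [Measure.volume_pi_eq_dirac, Measure.dirac_apply' _ (cutSet_measurable _ _ _ _)]
    by_cases h : R 0 * s ≤ t
    · have : 0 ≤ t - s * R 0 := by linarith
      simp [cutSet, tpow, this, h, hs, Set.indicator]
    · have : ¬ (0 ≤ t - s * R 0) := by intro; apply h; linarith
      simp [cutSet, tpow, this, h, hs, Set.indicator]
  | succ m ih =>
    intro R hR s t hs
    have hR' : Function.Injective (fun i : Fin (m + 1) => R i.succ) :=
      hR.comp (Fin.succ_injective _)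
    set f : ℝ → ℝ := fun u => wsum m (fun i => R i.succ) (s - u) (t - R 0 * u) with hf
    have hint : IntegrableOn f (Set.Ioc 0 s) := by
      have := wsum_integrand_intervalIntegrable m R s t
      rwa [intervalIntegrable_iff_integrableOn_Ioc_of_le hs] at this
    have hw : wsum (m + 1) R s t = ∫ u in Set.Ioc 0 s, f u := by
      rw [← wsum_succ m R hR, intervalIntegral.integral_of_le hs]
    have hf0 : ∀ u ∈ Set.Ioc 0 s, 0 ≤ f u := fun u hu =>
      (ih _ hR' (s - u) (t - R 0 * u) (by linarith [hu.2])).2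
    refine ⟨?_, ?_⟩
    · have mp := (volume_preserving_piFinSuccAbove (fun _ : Fin (m + 1) => ℝ) 0).symm
      rw [← mp.measure_preimage (cutSet_measurable _ _ _ _).nullMeasurableSet]
      have hms := mp.measurable (cutSet_measurable (m + 1) R s t)
      rw [Measure.volume_eq_prod, Measure.prod_apply hms]
      have hpre : ∀ u : ℝ, (Prod.mk u ⁻¹'
          ((MeasurableEquiv.piFinSuccAbove (fun _ : Fin (m + 1) => ℝ) 0).symm ⁻¹'
            cutSet (m + 1) R s t))
          = {y | 0 ≤ u ∧ y ∈ cutSet m (fun i => R i.succ) (s - u) (t - R 0 * u)} := by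
        intro u
        ext y
        rw [Set.mem_ofPred_eq, ← cutSet_cons]
        simp [MeasurableEquiv.piFinSuccAbove, Fin.insertNthEquiv, Fin.insertNth_zero']
      simp only [hpre]
      rw [hw, ofReal_integral_eq_lintegral_ofReal hint
        ((ae_restrict_iff' measurableSet_Ioc).2 (Filter.Eventually.of_forall hf0)),
        ← lintegral_indicator measurableSet_Ioc]
      apply lintegral_congr_ae
      have h0 : ∀ᵐ u : ℝ, u ≠ 0 := by
        simp [ae_iff]
      filter_upwards [h0] with u hu
      by_cases hmem : u ∈ Set.Ioc 0 s
      · rw [Set.indicator_of_mem hmem]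
        simp only [hmem.1.le, true_and, Set.ofPred_mem_eq]
        exact (ih _ hR' (s - u) (t - R 0 * u) (by linarith [hmem.2])).1
      · rw [Set.indicator_of_notMem hmem]
        by_cases hu0 : 0 ≤ u
        · have : s - u < 0 := by
            by_contra hc
            exact hmem ⟨lt_of_le_of_ne hu0 hu.symm, by linarith⟩
          simp [cutSet_empty _ _ _ _ this]
        · simp [hu0]
    · rw [hw]
      exact setIntegral_nonneg measurableSet_Ioc hf0

/-- Linear parametrization of the direction of the simplex. -/
noncomputable def dirMap (m : ℕ) : (Fin m → ℝ) →ₗ[ℝ] EuclideanSpace ℝ (Fin (m + 1)) where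
  toFun y := WithLp.toLp 2 (Fin.snoc (α := fun _ => ℝ) y (-∑ i, y i))
  map_add' x y := by
    ext i
    refine Fin.lastCases ?_ (fun i => ?_) i
    · simp [Finset.sum_add_distrib]; ring
    · simp
  map_smul' c y := by
    ext i
    refine Fin.lastCases ?_ (fun i => ?_) i
    · simp [Finset.mul_sum]
    · simp

theorem dirMap_castSucc (m : ℕ) (y : Fin m → ℝ) (i : Fin m) : dirMap m y i.castSucc = y i := by
  simp [dirMap]

theorem dirMap_last (m : ℕ) (y : Fin m → ℝ) : dirMap m y (Fin.last m) = -∑ i, y i := by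
  simp [dirMap]

theorem dirMap_injective (m : ℕ) : Function.Injective (dirMap m) := by
  intro x y h
  ext i
  rw [← dirMap_castSucc m x, h, dirMap_castSucc]

/-- Affine parametrization of the hyperplane of the simplex. -/
noncomputable def affMap (m : ℕ) (y : Fin m → ℝ) : EuclideanSpace ℝ (Fin (m + 1)) :=
  EuclideanSpace.single (Fin.last m) 1 + dirMap m y

theorem affMap_castSucc (m : ℕ) (y : Fin m → ℝ) (i : Fin m) : affMap m y i.castSucc = y i := by
  simp [affMap, dirMap_castSucc, Fin.castSucc_ne_last]

theorem affMap_last (m : ℕ) (y : Fin m → ℝ) : affMap m y (Fin.last m) = 1 - ∑ i, y i := by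
  simp [affMap, dirMap_last]; ring

theorem affMap_surj (m : ℕ) (x : EuclideanSpace ℝ (Fin (m + 1))) (hx : ∑ i, x i = 1) :
    affMap m (fun i => x i.castSucc) = x := by
  ext i
  refine Fin.lastCases ?_ (fun i => ?_) i
  · rw [affMap_last, ← hx, Fin.sum_univ_castSucc]; ring
  · rw [affMap_castSucc]

theorem hausdorff_affMap (m : ℕ) : ∃ c : ENNReal, c ≠ 0 ∧ c ≠ ⊤ ∧
    ∀ S : Set (Fin m → ℝ), MeasurableSet S →
      (μH[(m : ℝ)] : Measure (EuclideanSpace ℝ (Fin (m + 1)))) (affMap m '' S) = c * volume S := by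
  let e0 := LinearEquiv.ofInjective (dirMap m) (dirMap_injective m)
  let e := e0.toContinuousLinearEquiv
  have hfr : Module.finrank ℝ (LinearMap.range (dirMap m)) = m := by
    rw [← e0.finrank_eq]; simp
  have hH : (μH[(m : ℝ)] : Measure (LinearMap.range (dirMap m))).IsAddHaarMeasure := by
    have := isAddHaarMeasure_hausdorffMeasure (E := LinearMap.range (dirMap m))
    rwa [hfr] at this
  let ν : Measure (Fin m → ℝ) := (μH[(m : ℝ)] : Measure (LinearMap.range (dirMap m))).map e.symm
  have hν : ν.IsAddHaarMeasure := e.symm.isAddHaarMeasure_map _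
  refine ⟨Measure.addHaarScalarFactor ν volume, ?_, ENNReal.coe_ne_top, ?_⟩
  · exact_mod_cast (Measure.addHaarScalarFactor_pos_of_isAddHaarMeasure ν volume).ne'
  · intro S hS
    have hν' := Measure.isAddLeftInvariant_eq_smul ν (volume : Measure (Fin m → ℝ))
    have h1 : ν S = (Measure.addHaarScalarFactor ν volume : ENNReal) * volume S := by
      conv_lhs => rw [hν']
      rfl
    rw [← h1]
    let ψ : LinearMap.range (dirMap m) → EuclideanSpace ℝ (Fin (m + 1)) :=
      fun v => EuclideanSpace.single (Fin.last m) 1 + (v : EuclideanSpace ℝ (Fin (m + 1)))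
    have hψ : Isometry ψ := (isometry_add_left _).comp isometry_subtype_coe
    have himg : affMap m '' S = ψ '' (e '' S) := by
      rw [Set.image_image]; rfl
    rw [himg, hψ.hausdorffMeasure_image (Or.inl (by positivity))]
    rw [Measure.map_apply e.symm.continuous.measurable hS]
    congr 1
    exact e.toEquiv.image_eq_preimage_symm S

theorem cut_image (m : ℕ) (R : Fin (m + 1) → ℝ) (t : ℝ) :
    {x : EuclideanSpace ℝ (Fin (m + 1)) | ∑ i, R i * x i ≤ t} ∩
      {x | (∀ i, 0 ≤ x i) ∧ ∑ i, x i = 1} = affMap m '' cutSet m R 1 t := by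
  have key2 : ∀ y, affMap m y ∈ {x : EuclideanSpace ℝ (Fin (m + 1)) | ∑ i, R i * x i ≤ t} ∩
      {x | (∀ i, 0 ≤ x i) ∧ ∑ i, x i = 1} ↔ y ∈ cutSet m R 1 t := by
    intro y
    simp only [Set.mem_inter_iff, Set.mem_ofPred_eq, add_sub_cancel, and_true, cutSet, Fin.sum_univ_castSucc,
      Fin.forall_fin_succ', affMap_last, affMap_castSucc, sub_nonneg]
    tauto
  ext x
  constructor
  · intro hx
    have hs := affMap_surj m x hx.2.2
    refine ⟨_, ?_, hs⟩
    rw [← key2, hs]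
    exact hx
  · rintro ⟨y, hy, rfl⟩
    exact (key2 y).2 hy

theorem wsum_one (m : ℕ) (R : Fin (m + 1) → ℝ) (t : ℝ) :
    wsum m R 1 t = ((m.factorial : ℝ))⁻¹ *
      ∑ i ∈ Finset.univ.filter (fun i : Fin (m + 1) => R i ≤ t),
        (t - R i) ^ m * ∏ j ∈ Finset.univ.erase i, (R j - R i)⁻¹ := by
  rw [wsum, Finset.sum_filter]
  congr 1
  refine Finset.sum_congr rfl fun i _ => ?_
  simp only [tpow, one_mul, sub_nonneg]
  split_ifs <;> simp

theorem portfolio_cdf_formula (n : ℕ) (hn : 1 ≤ n) (R : Fin n → ℝ)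
    (hR : Function.Injective R) :
    let Δ : Set (EuclideanSpace ℝ (Fin n)) := {x | (∀ i, 0 ≤ x i) ∧ ∑ i, x i = 1}
    let μ0 : Measure (EuclideanSpace ℝ (Fin n)) := (μH[(n : ℝ) - 1]).restrict Δ
    let μ : Measure (EuclideanSpace ℝ (Fin n)) := (μ0 Set.univ)⁻¹ • μ0
    ∀ Rstar : ℝ,
      (μ {x | ∑ i, R i * x i ≤ Rstar}).toReal
        = ∑ i ∈ Finset.univ.filter (fun i : Fin n => R i ≤ Rstar),
            (Rstar - R i) ^ (n - 1) * ∏ j ∈ Finset.univ.erase i, (R j - R i)⁻¹ := by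
  obtain ⟨m, rfl⟩ : ∃ m, n = m + 1 := ⟨n - 1, by omega⟩
  intro Δ μ0 μ t
  have hd : ((m + 1 : ℕ) : ℝ) - 1 = m := by push_cast; ring
  obtain ⟨c, hc0, hct, hc⟩ := hausdorff_affMap m
  have hmeas : ∀ t : ℝ, MeasurableSet
      {x : EuclideanSpace ℝ (Fin (m + 1)) | ∑ i, R i * x i ≤ t} := fun t =>
    (isClosed_le (by fun_prop) (by fun_prop)).measurableSet
  have h0 : ∀ t, μ0 {x | ∑ i, R i * x i ≤ t} = c * ENNReal.ofReal (wsum m R 1 t) := by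
    intro t
    rw [Measure.restrict_apply (hmeas t), hd, cut_image, hc _ (cutSet_measurable _ _ _ _),
      (volume_cutSet m R hR 1 t zero_le_one).1]
  have hfac : (0 : ℝ) < (m.factorial : ℝ)⁻¹ := by positivity
  have huniv : μ0 Set.univ = c * ENNReal.ofReal ((m.factorial : ℝ)⁻¹) := by
    obtain ⟨T, hT⟩ : ∃ T, ∀ i, R i ≤ T := by
      obtain ⟨T, hT⟩ := (Set.finite_range R).bddAbove
      exact ⟨T, fun i => hT ⟨i, rfl⟩⟩
    have hwT : wsum m R 1 T = (m.factorial : ℝ)⁻¹ := by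
      rw [wsum_one, Finset.filter_true_of_mem (fun i _ => hT i), sum_weights_pow m R hR, mul_one]
    rw [← hwT, ← h0, Measure.restrict_apply (hmeas T), Measure.restrict_apply MeasurableSet.univ]
    congr 1
    ext x
    simp only [Set.univ_inter, Set.mem_inter_iff]
    refine ⟨fun hx => ⟨?_, hx⟩, fun hx => hx.2⟩
    calc ∑ i, R i * x i ≤ ∑ i, T * x i :=
          Finset.sum_le_sum fun i _ => mul_le_mul_of_nonneg_right (hT i) (hx.1 i)
      _ = T := by rw [← Finset.mul_sum, hx.2, mul_one]
  have hmu : μ {x | ∑ i, R i * x i ≤ t}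
      = (μ0 Set.univ)⁻¹ * μ0 {x | ∑ i, R i * x i ≤ t} := rfl
  have hctr : c.toReal ≠ 0 := ENNReal.toReal_ne_zero.2 ⟨hc0, hct⟩
  rw [hmu, huniv, h0, ENNReal.toReal_mul, ENNReal.toReal_inv, ENNReal.toReal_mul,
    ENNReal.toReal_mul, ENNReal.toReal_ofReal hfac.le,
    ENNReal.toReal_ofReal (volume_cutSet m R hR 1 t zero_le_one).2, wsum_one]
  rw [Nat.add_sub_cancel]
  field_simp
end

section
/- Let μ be the uniform probability measure on the standard simplex Δ^{n-1} ⊂ ℝ^n and R ∈ ℝ^n with kurtosis Kurt(R) = (1/Var(R)^2)·(1/n)∑(R_i − M_1)^4, where M_1 and Var(R) are the sample mean and biased sample variance of R and Var(R) > 0. Then the kurtosis M_4 of x ↦ ∑ R_i x_i under μ satisfies M_4 = 3(n+1)(2·Kurt(R) + n)/((n+2)(n+3)). -/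
open MeasureTheory

noncomputable def gExp (t : ℝ) : ℝ := (Set.Ici (0:ℝ)).indicator (fun t => Real.exp (-t)) t

lemma gExp_pow_eq (k : ℕ) : (fun t : ℝ => t ^ k * gExp t) =
    (Set.Ici (0:ℝ)).indicator (fun t => Real.exp (-t) * t ^ (((k:ℝ) + 1) - 1)) := by
  funext t
  by_cases h : t ∈ Set.Ici (0:ℝ)
  · simp [gExp, h, Real.rpow_natCast, mul_comm]
  · simp [gExp, h]

lemma gExp_pow_integrable (k : ℕ) : Integrable (fun t : ℝ => t ^ k * gExp t) := by
  rw [gExp_pow_eq, integrable_indicator_iff measurableSet_Ici, integrableOn_Ici_iff_integrableOn_Ioi]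
  exact Real.GammaIntegral_convergent (by positivity)

lemma gExp_pow_integral (k : ℕ) : ∫ t : ℝ, t ^ k * gExp t = k.factorial := by
  rw [gExp_pow_eq, integral_indicator measurableSet_Ici, integral_Ici_eq_integral_Ioi, ← Real.Gamma_eq_integral (by positivity),
    Real.Gamma_nat_eq_factorial]

lemma gExp_cent_integrable (k : ℕ) : Integrable (fun t : ℝ => (t - 1) ^ k * gExp t) := by
  have : (fun t : ℝ => (t - 1) ^ k * gExp t) = fun t => ∑ j ∈ Finset.range (k+1),
      ((-1)^(k-j) * (k.choose j : ℝ)) * (t ^ j * gExp t) := by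
    funext t
    rw [sub_eq_add_neg, add_pow, Finset.sum_mul]
    exact Finset.sum_congr rfl fun j _ => by ring
  rw [this]
  exact integrable_finsetSum _ fun j _ => (gExp_pow_integrable j).const_mul _

lemma gExp_cent_integral (k : ℕ) : ∫ t : ℝ, (t - 1) ^ k * gExp t =
    ∑ j ∈ Finset.range (k+1), ((-1)^(k-j) * (k.choose j : ℝ)) * j.factorial := by
  have : (fun t : ℝ => (t - 1) ^ k * gExp t) = fun t => ∑ j ∈ Finset.range (k+1),
      ((-1)^(k-j) * (k.choose j : ℝ)) * (t ^ j * gExp t) := by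
    funext t
    rw [sub_eq_add_neg, add_pow, Finset.sum_mul]
    exact Finset.sum_congr rfl fun j _ => by ring
  rw [this, integral_finsetSum _ fun j _ => (gExp_pow_integrable j).const_mul _]
  exact Finset.sum_congr rfl fun j _ => by rw [integral_const_mul, gExp_pow_integral]

/-- weighted power of the centred sum -/
noncomputable def cmom {n : ℕ} (a : Fin n → ℝ) (k : ℕ) (x : Fin n → ℝ) : ℝ :=
  (∑ i, a i * (x i - 1)) ^ k * ∏ i, gExp (x i)

lemma cmom_succ {n : ℕ} (a : Fin (n+1) → ℝ) (k : ℕ) :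
    (cmom a k) = (fun q : ℝ × (Fin n → ℝ) => ∑ j ∈ Finset.range (k+1),
      ((k.choose j : ℝ) * a 0 ^ j) * (((q.1 - 1) ^ j * gExp q.1) *
        cmom (fun i => a i.succ) (k - j) q.2)) ∘
      (MeasurableEquiv.piFinSuccAbove (fun _ : Fin (n+1) => ℝ) 0) := by
  funext x
  simp only [cmom, Function.comp, Fin.sum_univ_succ (n := n), Fin.prod_univ_succ (n := n)]
  rw [add_pow, Finset.sum_mul]
  refine Finset.sum_congr rfl fun j _ => ?_
  simp only [MeasurableEquiv.piFinSuccAbove_apply, Fin.insertNthEquiv_zero, Fin.consEquiv_symm_apply, Fin.tail]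
  rw [mul_pow]
  ring

lemma cmom_integrable {n : ℕ} (a : Fin n → ℝ) (k : ℕ) : Integrable (cmom a k) := by
  induction n generalizing k with
  | zero => 
    have : cmom a k = fun _ => (0:ℝ)^k := by funext x; simp [cmom]
    rw [this, Measure.volume_pi_eq_dirac a]
    exact integrable_const _
  | succ n ih =>
    rw [cmom_succ]
    refine (volume_preserving_piFinSuccAbove (fun _ : Fin (n+1) => ℝ) 0).integrable_comp_of_integrable ?_
    refine integrable_finsetSum _ fun j _ => Integrable.const_mul ?_ _
    exact (gExp_cent_integrable j).mul_prod (ih _ _)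

lemma cmom_integral_succ {n : ℕ} (a : Fin (n+1) → ℝ) (k : ℕ) :
    ∫ x, cmom a k x = ∑ j ∈ Finset.range (k+1), ((k.choose j : ℝ) * a 0 ^ j) *
      ((∫ t : ℝ, (t - 1) ^ j * gExp t) * ∫ y, cmom (fun i => a i.succ) (k - j) y) := by
  rw [cmom_succ]
  simp only [Function.comp_apply]
  have hmp := volume_preserving_piFinSuccAbove (fun _ : Fin (n+1) => ℝ) 0
  rw [hmp.integral_comp (MeasurableEquiv.measurableEmbedding _)
    (fun q : ℝ × (Fin n → ℝ) => ∑ j ∈ Finset.range (k+1),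
      ((k.choose j : ℝ) * a 0 ^ j) * (((q.1 - 1) ^ j * gExp q.1) *
        cmom (fun i => a i.succ) (k - j) q.2))]
  rw [Measure.volume_eq_prod, integral_finsetSum]
  · refine Finset.sum_congr rfl fun j _ => ?_
    rw [integral_const_mul, integral_prod_mul (fun t : ℝ => (t - 1) ^ j * gExp t)]
  · intro j _
    exact ((gExp_cent_integrable j).mul_prod (cmom_integrable _ _)).const_mul _

lemma cmom_values {n : ℕ} (a : Fin n → ℝ) :
    (∫ x, cmom a 0 x) = 1 ∧ (∫ x, cmom a 1 x) = 0 ∧ (∫ x, cmom a 2 x) = ∑ i, a i ^ 2 ∧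
    (∫ x, cmom a 4 x) = 6 * ∑ i, a i ^ 4 + 3 * (∑ i, a i ^ 2) ^ 2 := by
  induction n with
  | zero =>
    have (k : ℕ) : cmom a k = fun _ => (0:ℝ)^k := by funext x; simp [cmom]
    simp [this, Measure.volume_pi_eq_dirac a]
  | succ n ih =>
    obtain ⟨h0, h1, h2, h4⟩ := ih (fun i => a i.succ)
    simp only [cmom_integral_succ, gExp_cent_integral, Fin.sum_univ_succ (n := n)]
    simp only [Finset.sum_range_succ, Finset.range_zero, Finset.sum_empty]
    simp [Nat.choose, Nat.factorial, h0, h1, h2, h4]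
    refine ⟨?_, ?_⟩ <;> ring_nf

lemma prod_gExp {n : ℕ} (x : Fin n → ℝ) : ∏ i, gExp (x i) =
    if (∀ i, 0 ≤ x i) then Real.exp (-∑ i, x i) else 0 := by
  split_ifs with h
  · rw [← Finset.sum_neg_distrib, Real.exp_sum]
    exact Finset.prod_congr rfl fun i _ => by simp [gExp, h i]
  · push Not at h
    obtain ⟨i, hi⟩ := h
    exact Finset.prod_eq_zero (Finset.mem_univ i) (by simp [gExp, hi])

noncomputable def sumL (m : ℕ) : EuclideanSpace ℝ (Fin (m+1)) →ₗ[ℝ] ℝ where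
  toFun x := ∑ i, x i
  map_add' x y := by simp [Finset.sum_add_distrib]
  map_smul' c x := by simp [Finset.mul_sum]

noncomputable abbrev Wsp (m : ℕ) : Submodule ℝ (EuclideanSpace ℝ (Fin (m+1))) := LinearMap.ker (sumL m)

noncomputable def pt (m : ℕ) : EuclideanSpace ℝ (Fin (m+1)) := EuclideanSpace.single 0 1

lemma sum_pt (m : ℕ) : ∑ i, pt m i = 1 := by simp [pt]

lemma sumL_pt (m : ℕ) : sumL m (pt m) = 1 := sum_pt m

lemma sum_W {m : ℕ} (w : Wsp m) : ∑ i, (w : EuclideanSpace ℝ (Fin (m+1))) i = 0 := w.2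

lemma finrank_W (m : ℕ) : Module.finrank ℝ (Wsp m) = m := by
  have h : sumL m ≠ 0 := fun h => by
    have := sumL_pt m
    rw [h] at this
    simp at this
  have := Module.Dual.finrank_ker_add_one_of_ne_zero (f := sumL m) h
  rw [finrank_euclideanSpace_fin] at this
  exact Nat.succ.inj this

instance haarW (m : ℕ) : (μH[(m:ℝ)] : Measure (Wsp m)).IsAddHaarMeasure := by
  have := isAddHaarMeasure_hausdorffMeasure (E := Wsp m)
  rwa [finrank_W] at this

noncomputable def eqvL (m : ℕ) : (ℝ × Wsp m) ≃ₗ[ℝ] (Fin (m+1) → ℝ) where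
  toFun q := fun i => q.1 * pt m i + (q.2 : EuclideanSpace ℝ (Fin (m+1))) i
  map_add' x y := by funext i; simp; ring
  map_smul' c x := by funext i; simp; ring
  invFun x := (∑ i, x i, ⟨WithLp.toLp 2 (fun i => x i - (∑ i, x i) * pt m i), by
    simp [sumL, ← Finset.mul_sum, sum_pt]⟩)
  left_inv q := by
    have h : ∑ i, (q.1 * pt m i + (q.2 : EuclideanSpace ℝ (Fin (m+1))) i) = q.1 := by
      rw [Finset.sum_add_distrib, ← Finset.mul_sum, sum_pt, sum_W]; simp
    ext i
    · exact h
    · simp only [h]; simp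
  right_inv x := by funext i; simp

noncomputable def simplexE (m : ℕ) : Set (EuclideanSpace ℝ (Fin (m+1))) :=
  {x | (∀ i, 0 ≤ x i) ∧ ∑ i, x i = 1}

lemma simplexE_meas (m : ℕ) : MeasurableSet (simplexE m) := by
  have h1 : IsClosed (simplexE m) := by
    have : simplexE m = (⋂ i, {x | 0 ≤ x i}) ∩ {x | ∑ i, x i = 1} := by
      ext x; simp [simplexE]
    rw [this]
    refine IsClosed.inter (isClosed_iInter fun i => isClosed_le (by fun_prop) (by fun_prop)) 
      (isClosed_eq (by fun_prop) (by fun_prop))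
  exact h1.measurableSet

lemma hausd_integral (m : ℕ) (f : EuclideanSpace ℝ (Fin (m+1)) → ℝ) :
    ∫ x in simplexE m, f x ∂μH[(m:ℝ)] =
      ∫ w : Wsp m, (simplexE m).indicator f (pt m + w) ∂μH[(m:ℝ)] := by
  set ψ : Wsp m → EuclideanSpace ℝ (Fin (m+1)) := fun w => pt m + w with hψ
  have hiso : Isometry ψ := (isometry_add_left (pt m)).comp isometry_subtype_coe
  have hemb : Topology.IsClosedEmbedding ψ := hiso.isClosedEmbedding
  have hmap := hiso.map_hausdorffMeasure (d := (m:ℝ)) (Or.inl (by positivity))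
  have := hemb.measurableEmbedding.integral_map (μ := μH[(m:ℝ)]) ((simplexE m).indicator f)
  rw [hmap] at this
  rw [← this, integral_indicator (simplexE_meas m), Measure.restrict_restrict (simplexE_meas m)]
  congr 2
  symm
  apply Set.inter_eq_left.2
  intro x hx
  refine ⟨⟨x - pt m, ?_⟩, ?_⟩
  · have h1 : sumL m x = 1 := hx.2
    simp [h1, sumL_pt]
  · simp [hψ]

lemma link (m : ℕ) : ∃ c : ℝ, ∀ (k : ℕ) (a : Fin (m+1) → ℝ), 
    Integrable (fun x : Fin (m+1) → ℝ => (∑ i, a i * x i) ^ k * ∏ i, gExp (x i)) →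
    ∫ x : Fin (m+1) → ℝ, (∑ i, a i * x i) ^ k * ∏ i, gExp (x i) =
     c * (m + k).factorial * ∫ x in simplexE m, (∑ i, a i * x i) ^ k ∂μH[(m:ℝ)] := by
  let e : (ℝ × Wsp m) ≃L[ℝ] (Fin (m+1) → ℝ) := (eqvL m).toContinuousLinearEquiv
  let ν : Measure (ℝ × Wsp m) := (volume : Measure ℝ).prod μH[(m:ℝ)]
  have hhaar : (ν.map e).IsAddHaarMeasure := e.isAddHaarMeasure_map ν
  have hvol := Measure.isAddLeftInvariant_eq_smul (volume : Measure (Fin (m+1) → ℝ)) (ν.map e)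
  set c0 := Measure.addHaarScalarFactor (volume : Measure (Fin (m+1) → ℝ)) (ν.map e) with hc0
  have hc0pos : c0 ≠ 0 := by
    intro h
    rw [h, zero_smul] at hvol
    exact (NeZero.ne (volume : Measure (Fin (m+1) → ℝ))) hvol
  refine ⟨c0, fun k a hint => ?_⟩
  set F : (Fin (m+1) → ℝ) → ℝ := fun x => (∑ i, a i * x i) ^ k * ∏ i, gExp (x i) with hF
  have hme : MeasurableEmbedding e := e.toHomeomorph.measurableEmbedding
  have hint2 : Integrable (fun q => F (e q)) ν := by
    have h1 : Integrable F (ν.map e) := by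
      rw [hvol] at hint
      have := (integrable_smul_measure (c := (c0 : ENNReal)) (by simpa using hc0pos) (by simp)).1 hint
      exact this
    exact hme.integrable_map_iff.1 h1
  rw [hvol, integral_smul_nnreal_measure, hme.integral_map, integral_prod _ hint2, NNReal.smul_def, smul_eq_mul, 
    mul_assoc]
  congr 1
  rw [hausd_integral]
  set J := ∫ w : Wsp m, (simplexE m).indicator (fun x => (∑ i, a i * x i) ^ k) (pt m + w) ∂μH[(m:ℝ)] with hJ
  have hsum (s : ℝ) (w : Wsp m) : ∑ i, e (s, w) i = s := by
    change ∑ i, (s * pt m i + (w : EuclideanSpace ℝ (Fin (m+1))) i) = s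
    rw [Finset.sum_add_distrib, ← Finset.mul_sum, sum_pt, sum_W]; simp
  have hslice : ∀ s : ℝ, s ≠ 0 → ∫ w, F (e (s, w)) ∂μH[(m:ℝ)] = (s ^ (m+k) * gExp s) * J := by
    intro s hs
    rcases lt_or_gt_of_ne hs with hs | hs
    · have : ∀ w, F (e (s, w)) = 0 := by
        intro w
        rw [hF]
        simp only [prod_gExp]
        rw [if_neg, mul_zero]
        intro h
        have := Finset.sum_nonneg fun i (_ : i ∈ Finset.univ) => h i
        rw [hsum] at this
        linarith
      simp [this, gExp, hs]
    · have h1 := Measure.integral_comp_smul_of_nonneg (μH[(m:ℝ)] : Measure (Wsp m))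
        (fun w => F (e (s, w))) s (hR := hs.le)
      rw [finrank_W] at h1
      have h2 : ∀ w : Wsp m, F (e (s, s • w)) = (s ^ k * Real.exp (-s)) *
          (simplexE m).indicator (fun x => (∑ i, a i * x i) ^ k) (pt m + w) := by
        intro w
        have h3 : ∀ i, e (s, s • w) i = s * (pt m + w) i := by
          intro i
          change s * pt m i + ((s • w : Wsp m) : EuclideanSpace ℝ (Fin (m+1))) i = _
          simp; ring
        have h4 : ∑ i, (pt m + w) i = 1 := by
          simp [Finset.sum_add_distrib, sum_pt, sum_W]
        rw [hF]
        simp only [prod_gExp, hsum]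
        simp only [h3, mul_nonneg_iff_of_pos_left hs]
        by_cases h5 : ∀ i, 0 ≤ (pt m + w) i
        · rw [if_pos h5, Set.indicator_of_mem (show _ ∈ simplexE m from ⟨h5, h4⟩)]
          simp only [mul_left_comm _ s, ← Finset.mul_sum, mul_pow]
          ring
        · rw [if_neg h5, Set.indicator_of_notMem (fun h => h5 h.1)]
          simp
      simp only [h2, integral_const_mul] at h1
      rw [← hJ, smul_eq_mul] at h1
      have h6 : s ^ m ≠ 0 := by positivity
      have h7 : gExp s = Real.exp (-s) := by simp [gExp, hs.le]
      rw [h7]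
      field_simp at h1
      rw [← h1]
      ring
  rw [integral_congr_ae (g := fun s => (s ^ (m+k) * gExp s) * J), integral_mul_const, gExp_pow_integral]
  filter_upwards [Measure.ae_ne volume (0:ℝ)] with s hs
  exact hslice s hs

theorem portfolio_kurtosis_mapping (n : ℕ) (hn : 1 ≤ n) (R : Fin n → ℝ) :
    let Δ : Set (EuclideanSpace ℝ (Fin n)) := {x | (∀ i, 0 ≤ x i) ∧ ∑ i, x i = 1}
    let μ0 : Measure (EuclideanSpace ℝ (Fin n)) := (μH[(n : ℝ) - 1]).restrict Δ
    let μ : Measure (EuclideanSpace ℝ (Fin n)) := (μ0 Set.univ)⁻¹ • μ0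
    let M₁ : ℝ := (1 / n) * ∑ i, R i
    let Var : ℝ := (1 / n) * ∑ i, (R i - M₁) ^ 2
    let Kurt : ℝ := (1 / Var ^ 2) * ((1 / n) * ∑ i, (R i - M₁) ^ 4)
    0 < Var →
      (∫ x, (∑ i, R i * x i - M₁) ^ 4 ∂μ) / (∫ x, (∑ i, R i * x i - M₁) ^ 2 ∂μ) ^ 2
        = 3 * (n + 1) * (2 * Kurt + n) / ((n + 2) * (n + 3)) := by
  obtain ⟨m, rfl⟩ : ∃ m, n = m + 1 := ⟨n - 1, by omega⟩
  intro Δ μ0 μ M₁ Var Kurt hVar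
  obtain ⟨c, hc⟩ := link m
  set a : Fin (m+1) → ℝ := fun i => R i - M₁ with ha
  have hΔ : Δ = simplexE m := rfl
  have hμ0 : μ0 = (μH[(m:ℝ)]).restrict (simplexE m) := by
    simp only [μ0, hΔ]; congr 2; push_cast; ring
  have ha0 : ∑ i, a i = 0 := by
    simp [ha, M₁, Finset.sum_sub_distrib]; field_simp; simp
  have hcm (k : ℕ) : (fun x : Fin (m+1) → ℝ => (∑ i, a i * x i) ^ k * ∏ i, gExp (x i)) = cmom a k := by
    funext x
    simp [cmom, mul_sub, Finset.sum_sub_distrib, ha0]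
  have hk (k : ℕ) := hc k a (by rw [hcm]; exact cmom_integrable a k)
  have hR (k : ℕ) : ∫ x, (∑ i, R i * x i - M₁) ^ k ∂μ = (μ0 Set.univ)⁻¹.toReal *
      ∫ x in simplexE m, (∑ i, a i * x i) ^ k ∂μH[(m:ℝ)] := by
    simp only [μ]
    rw [integral_smul_measure, smul_eq_mul, hμ0]
    congr 1
    refine setIntegral_congr_fun (simplexE_meas m) fun x hx => ?_
    have := hx.2
    simp [ha, sub_mul, Finset.sum_sub_distrib, ← Finset.mul_sum, this]
  rw [hR, hR]
  simp only [hcm] at hk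
  obtain ⟨v0, -, v2, v4⟩ := cmom_values a
  have k0 := hk 0
  have k2 := hk 2
  have k4 := hk 4
  rw [v0] at k0
  rw [v2] at k2
  rw [v4] at k4
  have hT : ∫ x in simplexE m, (∑ i, a i * x i) ^ 0 ∂μH[(m:ℝ)] = (μ0 Set.univ).toReal := by
    simp [hμ0, Measure.real]
  rw [hT] at k0
  rw [ENNReal.toReal_inv]
  set T := (μ0 Set.univ).toReal
  set J2 := ∫ x in simplexE m, (∑ i, a i * x i) ^ 2 ∂μH[(m:ℝ)]
  set J4 := ∫ x in simplexE m, (∑ i, a i * x i) ^ 4 ∂μH[(m:ℝ)]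
  set p2 := ∑ i, a i ^ 2 with hp2
  set p4 := ∑ i, a i ^ 4 with hp4
  have hV : Var = (1 / ((m + 1 : ℕ) : ℝ)) * p2 := rfl
  have hK : Kurt = (1 / Var ^ 2) * ((1 / ((m + 1 : ℕ) : ℝ)) * p4) := rfl
  have hp2pos : p2 ≠ 0 := by
    rintro h; rw [hV, h] at hVar; simp at hVar
  rw [hK, hV]
  simp only [Nat.factorial, Nat.add_zero] at k0 k2 k4
  push_cast at k0 k2 k4 ⊢
  have hfac : (m.factorial : ℝ) ≠ 0 := by positivity
  set q := (m.factorial : ℝ)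
  have hcne : c ≠ 0 := by rintro rfl; simp at k0
  have hTne : T ≠ 0 := by intro h; rw [h] at k0; simp at k0
  have hT' : T = 1 / (c * q) := by field_simp; linarith
  have hJ2 : J2 = p2 / (c * ((m + 2) * (m + 1) * q)) := by
    field_simp; rw [k2]; ring
  have hJ4 : J4 = (6 * p4 + 3 * p2 ^ 2) / (c * ((m + 4) * (m + 3) * (m + 2) * (m + 1) * q)) := by
    field_simp; rw [k4]; ring
  rw [hJ2, hJ4, hT']
  field_simp
  ring
end
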